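/- arXiv:cond-mat/0703014 — 2 statements merged into one kernel-verified Lean document; each statement's English description precedes it below -/
import Mathlib

section
/- Let L be an even positive integer. Let N'_L denote the number of orbits of the set of non-crossing partitions of {1,…,L} under the cyclic group generated by the rotation ρ₂ (ρ₂(i) = i+2 reduced modulo L to lie in {1,…,L}), acting on partitions by σ·P = {σ(B) : B ∈ P}, and let C_L be the number of non-crossing partitions of {1,…,L}. Then (L/2)·N'_L − C_L = Σ_{d even, d | L, 1 ≤ d < L} φ(L/d)·binom(2d, d), where φ is Euler's totient function. (Lemma 2.1 of the paper, relating N'_{Z,hc,PF,L_y} to N_{Z,tri,FF,L_y} = C_{L_y}.) -/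
open Finset

/-- A partition `P` of `{1,…,L}` (modeled as `Fin L`) is non-crossing if there are no
indices `a < b < c < d` with `a, c` in one block of `P` and `b, d` in a different block. -/
def NonCrossing {L : ℕ} (P : Finpartition (Finset.univ : Finset (Fin L))) : Prop :=
  ¬ ∃ a b c d : Fin L, a < b ∧ b < c ∧ c < d ∧
      ∃ B₁ ∈ P.parts, ∃ B₂ ∈ P.parts, B₁ ≠ B₂ ∧ a ∈ B₁ ∧ c ∈ B₁ ∧ b ∈ B₂ ∧ d ∈ B₂

/-- The set of parts of the image `σ·P = {σ(B) : B ∈ P}` of a partition `P` under a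
permutation `σ`. -/
def permParts {L : ℕ} (σ : Equiv.Perm (Fin L))
    (P : Finpartition (Finset.univ : Finset (Fin L))) : Finset (Finset (Fin L)) :=
  P.parts.image (fun B => B.image σ)

/-- The orbit of a partition `P` under a subgroup `H` of permutations (acting by
`σ·P = {σ(B) : B ∈ P}`), as a set of partitions. -/
def orbitSet {L : ℕ} (H : Subgroup (Equiv.Perm (Fin L)))
    (P : Finpartition (Finset.univ : Finset (Fin L))) :
    Set (Finpartition (Finset.univ : Finset (Fin L))) :=
  {Q | ∃ σ ∈ H, Q.parts = permParts σ P}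

/-- Linear non-crossing condition for an equivalence relation on `ℤ`. -/
def IntNonCrossing (r : Setoid ℤ) : Prop :=
  ∀ a b c d : ℤ, a < b → b < c → c < d → r a c → r b d → r a b

/-- The elements of `ℤ` that are not the last one of their class. -/
def openers (r : Setoid ℤ) : Set ℤ := {i | ∃ j, i < j ∧ r i j}

/-- The elements of `ℤ` that are not the first one of their class. -/
def closers (r : Setoid ℤ) : Set ℤ := {i | ∃ j, j < i ∧ r j i}

/-- The increment of the height function of a pair of sets of openers and closers. -/
noncomputable def heightStep (A B : Set ℤ) (x : ℤ) : ℤ :=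
  A.indicator 1 x - B.indicator 1 (x + 1)

/-- The height function on `ℤ`, vanishing at `0`, with increments `heightStep`. -/
noncomputable def height (A B : Set ℤ) (k : ℤ) : ℤ :=
  ∑ x ∈ Ico 0 k, heightStep A B x - ∑ x ∈ Ico k 0, heightStep A B x

/-- `i ≤ j` lie at the same level of the path, which does not go below this level between them. -/
def SameLevel (A B : Set ℤ) (i j : ℤ) : Prop :=
  i ≤ j ∧ height A B i = height A B j ∧
    ∀ k, i ≤ k → k ≤ j → height A B i ≤ height A B k ∧
      (k < j → height A B k = height A B i → k ∈ A)

lemma height_zero (A B : Set ℤ) : height A B 0 = 0 := by simp [height]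

lemma height_succ (A B : Set ℤ) (k : ℤ) :
    height A B (k + 1) = height A B k + heightStep A B k := by
  unfold height
  rcases le_or_gt 0 k with h | h
  · rw [← Finset.insert_Ico_right_eq_Ico_add_one h, Finset.sum_insert (by simp),
      Finset.Ico_eq_empty_of_le h, Finset.Ico_eq_empty_of_le (by lia : 0 ≤ k + 1)]
    simp [add_comm]
  · rw [← Finset.insert_Ico_add_one_left_eq_Ico h, Finset.sum_insert (by simp),
      Finset.Ico_eq_empty_of_le h.le, Finset.Ico_eq_empty_of_le (by lia : k + 1 ≤ 0)]
    simp

lemma heightStep_cases (A B : Set ℤ) (k : ℤ) :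
    (k ∈ A ∧ k + 1 ∈ B ∧ heightStep A B k = 0) ∨ (k ∈ A ∧ k + 1 ∉ B ∧ heightStep A B k = 1) ∨
    (k ∉ A ∧ k + 1 ∈ B ∧ heightStep A B k = -1) ∨ (k ∉ A ∧ k + 1 ∉ B ∧ heightStep A B k = 0) := by
  by_cases h1 : k ∈ A <;> by_cases h2 : k + 1 ∈ B <;> simp [heightStep, h1, h2]

open scoped Classical in
lemma height_sub (A B : Set ℤ) {i k : ℤ} (h : i ≤ k) :
    height A B k - height A B i = #{x ∈ Ico i k | x ∈ A} - #{x ∈ Ioc i k | x ∈ B} := by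
  induction k, h using Int.leInduction with
  | base => simp
  | succ k h ih =>
    rw [height_succ, ← Finset.insert_Ico_right_eq_Ico_add_one h,
      ← Finset.insert_Ioc_right_eq_Ioc_add_one (by lia), Finset.filter_insert, Finset.filter_insert]
    rcases heightStep_cases A B k with ⟨h1, h2, h3⟩ | ⟨h1, h2, h3⟩ | ⟨h1, h2, h3⟩ | ⟨h1, h2, h3⟩ <;>
    simp [h1, h2, h3] <;> lia

namespace SameLevel

variable {A B : Set ℤ} {i j k : ℤ}

lemma trans (h₁ : SameLevel A B i j) (h₂ : SameLevel A B j k) : SameLevel A B i k := by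
  obtain ⟨a1, a2, a3⟩ := h₁
  obtain ⟨b1, b2, b3⟩ := h₂
  refine ⟨by lia, by lia, fun l h1 h2 => ?_⟩
  rcases lt_or_ge l j with h | h
  · have := a3 l h1 h.le
    exact ⟨by lia, fun _ => this.2 h⟩
  · have := b3 l h h2
    exact ⟨by lia, fun h3 h4 => this.2 h3 (by lia)⟩

lemma of_left (h₁ : SameLevel A B i k) (h₂ : SameLevel A B j k) (h : i ≤ j) :
    SameLevel A B i j := by
  obtain ⟨a1, a2, a3⟩ := h₁
  obtain ⟨b1, b2, b3⟩ := h₂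
  refine ⟨h, by lia, fun l h1 h2 => ?_⟩
  have := a3 l h1 (by lia)
  exact ⟨this.1, fun h3 => this.2 (by lia)⟩

lemma of_right (h₁ : SameLevel A B i j) (h₂ : SameLevel A B i k) (h : j ≤ k) :
    SameLevel A B j k := by
  obtain ⟨a1, a2, a3⟩ := h₁
  obtain ⟨b1, b2, b3⟩ := h₂
  refine ⟨h, by lia, fun l h1 h2 => ?_⟩
  have := b3 l (by lia) (by lia)
  exact ⟨by lia, fun h3 h4 => this.2 (by lia) (by lia)⟩

lemma mem_left (h : SameLevel A B i j) (hij : i < j) : i ∈ A :=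
  (h.2.2 i le_rfl hij.le).2 hij rfl

lemma mem_right (h : SameLevel A B i j) (hij : i < j) : j ∈ B := by
  have h1 := h.2.2 (j - 1) (by lia) (by lia)
  have h2 := height_succ A B (j - 1)
  have h3 := heightStep_cases A B (j - 1)
  have h4 := h.2.1
  have h5 := h1.2 (by lia)
  rw [sub_add_cancel] at h2 h3
  by_contra hB
  simp only [hB, false_and, and_false, not_false_eq_true, true_and, false_or] at h3
  rcases h3 with ⟨a, b⟩ | ⟨a, b⟩
  · lia
  · exact a (h5 (by lia))

end SameLevel

/-- The equivalence relation on `ℤ` determined by sets of openers and closers. -/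
def levelSetoid (A B : Set ℤ) : Setoid ℤ where
  r i j := SameLevel A B i j ∨ SameLevel A B j i
  iseqv := by
    refine ⟨fun i => Or.inl ⟨le_rfl, rfl, fun k h1 h2 => ?_⟩, Or.symm, ?_⟩
    · obtain rfl : i = k := by lia
      simp
    · rintro x y z (h | h) (h' | h')
      · exact Or.inl (h.trans h')
      · rcases le_total x z with hh | hh
        · exact Or.inl (h.of_left h' hh)
        · exact Or.inr (h'.of_left h hh)
      · rcases le_total x z with hh | hh
        · exact Or.inl (h.of_right h' hh)
        · exact Or.inr (h'.of_right h hh)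
      · exact Or.inr (h'.trans h)

lemma levelSetoid_iff {A B : Set ℤ} {i j : ℤ} (h : i ≤ j) :
    levelSetoid A B i j ↔ SameLevel A B i j := by
  refine ⟨?_, Or.inl⟩
  rintro (h' | h')
  · exact h'
  · obtain rfl : i = j := le_antisymm h h'.1
    exact h'

lemma levelSetoid_nonCrossing (A B : Set ℤ) : IntNonCrossing (levelSetoid A B) := by
  intro a b c d hab hbc hcd h1 h2
  rw [levelSetoid_iff (by lia)] at h1 h2 ⊢
  obtain ⟨a1, a2, a3⟩ := h1
  obtain ⟨b1, b2, b3⟩ := h2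
  have e1 := (a3 b hab.le hbc.le).1
  have e2 := (b3 c hbc.le hcd.le).1
  refine ⟨hab.le, by lia, fun k hk1 hk2 => ?_⟩
  have := a3 k hk1 (by lia)
  exact ⟨this.1, fun _ => this.2 (by lia)⟩

lemma openers_levelSetoid {A B : Set ℤ}
    (h : ∀ i, ∃ k, i < k ∧ height A B k ≤ height A B i) : openers (levelSetoid A B) = A := by
  ext i
  constructor
  · rintro ⟨j, hij, hr⟩
    exact ((levelSetoid_iff hij.le).1 hr).mem_left hij
  · intro hi
    obtain ⟨k, ⟨hk1, hk2⟩, hk3⟩ := Int.exists_least_of_bdd ⟨i, fun z hz => hz.1.le⟩ (h i)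
    have h1 := height_succ A B (k - 1)
    have h2 := heightStep_cases A B (k - 1)
    rw [sub_add_cancel] at h1 h2
    have hk : height A B k = height A B i := by
      rcases eq_or_lt_of_le (by lia : i ≤ k - 1) with e | e
      · rw [← e] at h1 h2
        simp only [hi, not_true_eq_false, true_and, false_and, or_false] at h2
        lia
      · have := mt (fun h => hk3 (k - 1) ⟨e, h⟩) (by lia)
        lia
    refine ⟨k, hk1, Or.inl ⟨hk1.le, hk.symm, fun l h3 h4 => ?_⟩⟩
    rcases eq_or_lt_of_le h3 with rfl | h3
    · exact ⟨le_rfl, fun _ _ => hi⟩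
    · rcases eq_or_lt_of_le h4 with rfl | h4
      · exact ⟨hk.ge, by simp⟩
      · have := mt (fun h => hk3 l ⟨h3, h⟩) (by lia)
        exact ⟨by lia, by lia⟩

lemma closers_levelSetoid {A B : Set ℤ}
    (h : ∀ i, ∃ k, k < i ∧ height A B k ≤ height A B i) : closers (levelSetoid A B) = B := by
  ext i
  constructor
  · rintro ⟨j, hij, hr⟩
    exact ((levelSetoid_iff hij.le).1 hr).mem_right hij
  · intro hi
    obtain ⟨k, ⟨hk1, hk2⟩, hk3⟩ := Int.exists_greatest_of_bdd ⟨i, fun z hz => hz.1.le⟩ (h i)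
    have h1 := height_succ A B k
    have h2 := heightStep_cases A B k
    have hk : height A B k = height A B i ∧ k ∈ A := by
      rcases eq_or_lt_of_le (by lia : k + 1 ≤ i) with e | e
      · rw [e] at h1 h2
        simp only [hi, not_true_eq_false, true_and, false_and, and_false, or_false, false_or] at h2
        by_cases hkA : k ∈ A <;> simp only [hkA, not_true_eq_false, not_false_eq_true, true_and,
          false_and, or_false, false_or] at h2 ⊢ <;> lia
      · have := mt (fun h => hk3 (k + 1) ⟨e, h⟩) (by lia)
        by_cases hkA : k ∈ A <;> simp only [hkA, not_true_eq_false, not_false_eq_true, true_and,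
          false_and, or_false, false_or] at h2 ⊢ <;> lia
    refine ⟨k, hk1, Or.inl ⟨hk1.le, hk.1, fun l h3 h4 => ?_⟩⟩
    rcases eq_or_lt_of_le h3 with rfl | h3
    · exact ⟨le_rfl, fun _ _ => hk.2⟩
    · rcases eq_or_lt_of_le h4 with rfl | h4
      · exact ⟨hk.1.le, by simp⟩
      · have := mt (fun h => hk3 l ⟨h4, h⟩) (by lia)
        exact ⟨by lia, by lia⟩

lemma exists_next {r : Setoid ℤ} {i : ℤ} (h : i ∈ openers r) :
    ∃ j, i < j ∧ r i j ∧ ∀ k, i < k → r i k → j ≤ k := by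
  obtain ⟨j, ⟨h1, h2⟩, h3⟩ := Int.exists_least_of_bdd ⟨i, fun z hz => hz.1.le⟩ h
  exact ⟨j, h1, h2, fun k hk hk' => h3 k ⟨hk, hk'⟩⟩

lemma exists_prev {r : Setoid ℤ} {i : ℤ} (h : i ∈ closers r) :
    ∃ j, j < i ∧ r j i ∧ ∀ k, k < i → r k i → k ≤ j := by
  obtain ⟨j, ⟨h1, h2⟩, h3⟩ := Int.exists_greatest_of_bdd ⟨i, fun z hz => hz.1.le⟩ h
  exact ⟨j, h1, h2, fun k hk hk' => h3 k ⟨hk, hk'⟩⟩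

open scoped Classical in
/-- The next element in the class of `i`, or `i` itself if there is none. -/
noncomputable def next (r : Setoid ℤ) (i : ℤ) : ℤ :=
  if h : i ∈ openers r then (exists_next h).choose else i

open scoped Classical in
/-- The previous element in the class of `i`, or `i` itself if there is none. -/
noncomputable def prev (r : Setoid ℤ) (i : ℤ) : ℤ :=
  if h : i ∈ closers r then (exists_prev h).choose else i

section NextPrev

variable {r : Setoid ℤ} {i j k : ℤ}

lemma next_spec (h : i ∈ openers r) :
    i < next r i ∧ r i (next r i) ∧ ∀ k, i < k → r i k → next r i ≤ k := by
  rw [next, dif_pos h]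
  exact (exists_next h).choose_spec

lemma prev_spec (h : i ∈ closers r) :
    prev r i < i ∧ r (prev r i) i ∧ ∀ k, k < i → r k i → k ≤ prev r i := by
  rw [prev, dif_pos h]
  exact (exists_prev h).choose_spec

lemma next_eq (hij : i < j) (h : r i j) (hk : ∀ k, i < k → r i k → j ≤ k) : next r i = j := by
  have := next_spec (r := r) ⟨j, hij, h⟩
  exact le_antisymm (this.2.2 j hij h) (hk _ this.1 this.2.1)

lemma prev_eq (hij : i < j) (h : r i j) (hk : ∀ k, k < j → r k j → k ≤ i) : prev r j = i := by
  have := prev_spec (r := r) ⟨i, hij, h⟩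
  exact le_antisymm (hk _ this.1 this.2.1) (this.2.2 i hij h)

lemma next_mem_closers (h : i ∈ openers r) : next r i ∈ closers r :=
  ⟨i, (next_spec h).1, (next_spec h).2.1⟩

lemma prev_mem_openers (h : i ∈ closers r) : prev r i ∈ openers r :=
  ⟨i, (prev_spec h).1, (prev_spec h).2.1⟩

lemma prev_next (h : i ∈ openers r) : prev r (next r i) = i := by
  obtain ⟨h1, h2, h3⟩ := next_spec h
  refine prev_eq h1 h2 fun k hk hk' => ?_
  by_contra! h4
  have := h3 k h4 (r.trans' h2 (r.symm' hk'))
  lia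

lemma next_prev (h : i ∈ closers r) : next r (prev r i) = i := by
  obtain ⟨h1, h2, h3⟩ := prev_spec h
  refine next_eq h1 h2 fun k hk hk' => ?_
  by_contra! h4
  have := h3 k h4 (r.trans' (r.symm' hk') h2)
  lia

lemma height_le_of_prev (hik : i ≤ k)
    (h : ∀ b, i < b → b ≤ k → b ∈ closers r → i ≤ prev r b) :
    height (openers r) (closers r) i ≤ height (openers r) (closers r) k := by
  classical
  have := height_sub (openers r) (closers r) hik
  have h2 := Finset.card_le_card_of_injOn (s := {x ∈ Ioc i k | x ∈ closers r})
    (t := {x ∈ Ico i k | x ∈ openers r}) (prev r)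
    (by
      intro b hb
      simp only [Finset.coe_filter, Finset.mem_Ioc, Finset.mem_Ico, Set.mem_ofPred_eq] at hb ⊢
      have := prev_spec hb.2
      exact ⟨⟨h b hb.1.1 hb.1.2 hb.2, by lia⟩, prev_mem_openers hb.2⟩)
    (by
      intro b hb c hc hbc
      simp only [Finset.coe_filter, Finset.mem_Ioc, Set.mem_ofPred_eq] at hb hc
      rw [← next_prev hb.2, ← next_prev hc.2, hbc])
  lia

lemma height_lt_of_prev (hik : i < k) (hi : i ∈ openers r)
    (h : ∀ b, i < b → b ≤ k → b ∈ closers r → i < prev r b) :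
    height (openers r) (closers r) i < height (openers r) (closers r) k := by
  have h1 := height_le_of_prev (i := i + 1) (r := r) hik fun b h1 h2 h3 => h b (by lia) h2 h3
  have h2 := height_succ (openers r) (closers r) i
  have h3 := heightStep_cases (openers r) (closers r) i
  have h4 : i + 1 ∉ closers r := fun hc => by
    have := h (i + 1) (by lia) hik hc
    have := (prev_spec hc).1
    lia
  simp only [hi, h4, not_true_eq_false, true_and, false_and, false_or, or_false] at h3
  lia

lemma height_ge_of_next (hik : i ≤ k)
    (h : ∀ a, i ≤ a → a < k → a ∈ openers r → next r a ≤ k) :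
    height (openers r) (closers r) k ≤ height (openers r) (closers r) i := by
  classical
  have := height_sub (openers r) (closers r) hik
  have h2 := Finset.card_le_card_of_injOn (t := {x ∈ Ioc i k | x ∈ closers r})
    (s := {x ∈ Ico i k | x ∈ openers r}) (next r)
    (by
      intro b hb
      simp only [Finset.coe_filter, Finset.mem_Ioc, Finset.mem_Ico, Set.mem_ofPred_eq] at hb ⊢
      have := next_spec hb.2
      exact ⟨⟨by lia, h b hb.1.1 hb.1.2 hb.2⟩, next_mem_closers hb.2⟩)
    (by
      intro b hb c hc hbc
      simp only [Finset.coe_filter, Finset.mem_Ico, Set.mem_ofPred_eq] at hb hc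
      rw [← prev_next hb.2, ← prev_next hc.2, hbc])
  lia

end NextPrev

namespace IntNonCrossing

variable {r : Setoid ℤ} {i j k : ℤ}

lemma le_prev (hr : IntNonCrossing r) (hij : r i j) (hik : i < k) (hkj : k ≤ j)
    (hk : k ∈ closers r) : i ≤ prev r k := by
  obtain ⟨h1, h2, h3⟩ := prev_spec hk
  by_contra! h
  rcases eq_or_lt_of_le hkj with rfl | hkj
  · have := h3 i hik hij
    lia
  · have := h3 i hik (r.trans' (r.symm' (hr _ _ _ _ h hik hkj h2 hij)) h2)
    lia

lemma height_le (hr : IntNonCrossing r) (hij : r i j) (hik : i ≤ k) (hkj : k ≤ j) :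
    height (openers r) (closers r) i ≤ height (openers r) (closers r) k :=
  height_le_of_prev hik fun _ h1 h2 h3 => hr.le_prev hij h1 (by lia) h3

lemma height_lt_next (hr : IntNonCrossing r) (hi : i ∈ openers r) (hik : i < k)
    (hk : k < next r i) :
    height (openers r) (closers r) i < height (openers r) (closers r) k := by
  obtain ⟨h1, h2, h3⟩ := next_spec hi
  refine height_lt_of_prev hik hi fun b hb1 hb2 hb => ?_
  refine lt_of_le_of_ne (hr.le_prev h2 hb1 (by lia) hb) fun h => ?_
  have := next_prev hb
  rw [← h] at this
  lia

lemma height_eq (hr : IntNonCrossing r) (hij : r i j) (h : i ≤ j) :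
    height (openers r) (closers r) i = height (openers r) (closers r) j := by
  refine le_antisymm (hr.height_le hij h le_rfl) (height_ge_of_next h fun a h1 h2 h3 => ?_)
  obtain ⟨h4, h5, h6⟩ := next_spec h3
  by_contra! h7
  rcases eq_or_lt_of_le h1 with rfl | h1
  · have := h6 j h2 hij
    lia
  · have := h6 j h2 (r.trans' (r.symm' (hr _ _ _ _ h1 h2 h7 hij h5)) hij)
    lia

lemma rel_of_height_eq (hr : IntNonCrossing r) (hij : r i j) (hik : i ≤ k) (hkj : k < j)
    (hk : height (openers r) (closers r) k = height (openers r) (closers r) i) : r i k := by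
  obtain ⟨l, ⟨h1, h2⟩, h3⟩ := Int.exists_greatest_of_bdd (P := fun l => l ≤ k ∧ r i l)
    ⟨k, fun z hz => hz.1⟩ ⟨i, hik, r.refl' i⟩
  rcases eq_or_lt_of_le h1 with rfl | h1
  · exact h2
  · have hl : l ∈ openers r := ⟨j, by lia, r.trans' (r.symm' h2) hij⟩
    have hn := next_spec hl
    have := hr.height_lt_next hl h1 (by
      by_contra! h
      have := h3 _ ⟨h, r.trans' h2 hn.2.1⟩
      lia)
    have := hr.height_eq h2 (h3 _ ⟨hik, r.refl' i⟩)
    lia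

lemma sameLevel (hr : IntNonCrossing r) (hij : r i j) (h : i ≤ j) :
    SameLevel (openers r) (closers r) i j :=
  ⟨h, hr.height_eq hij h, fun _ h1 h2 => ⟨hr.height_le hij h1 h2, fun h3 h4 =>
    ⟨j, h3, r.trans' (r.symm' (hr.rel_of_height_eq hij h1 h3 h4)) hij⟩⟩⟩

lemma rel_of_sameLevel (hr : IntNonCrossing r) (h : SameLevel (openers r) (closers r) i j) :
    r i j := by
  induction hn : (j - i).toNat using Nat.strong_induction_on generalizing i with
  | _ n ih =>
    rcases eq_or_lt_of_le h.1 with rfl | hij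
    · exact r.refl' _
    have hi := h.mem_left hij
    obtain ⟨h1, h2, h3⟩ := next_spec hi
    rcases le_or_gt (next r i) j with h4 | h4
    · exact r.trans' h2 (ih _ (by lia) ((hr.sameLevel h2 h1.le).of_right h h4) rfl)
    · have := hr.height_lt_next hi hij h4
      have := h.2.1
      lia

/-- A non-crossing equivalence relation on `ℤ` is determined by its openers and closers. -/
lemma levelSetoid_eq (hr : IntNonCrossing r) : levelSetoid (openers r) (closers r) = r := by
  have key : ∀ i j, SameLevel (openers r) (closers r) i j → r i j :=
    fun i j => hr.rel_of_sameLevel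
  ext i j
  constructor
  · rintro (h | h)
    · exact key _ _ h
    · exact r.symm' (key _ _ h)
  · intro h
    rcases le_total i j with h' | h'
    · exact Or.inl (hr.sameLevel h h')
    · exact Or.inr (hr.sameLevel (r.symm' h) h')

end IntNonCrossing

/-- Invariance of a relation on `ℤ` under translation by `t`. -/
def ShiftInvariant (t : ℤ) (r : Setoid ℤ) : Prop := ∀ x y, r (x + t) (y + t) ↔ r x y

/-- The group of translations of `ℤ` preserving `r`. -/
def shiftSubgroup (r : Setoid ℤ) : AddSubgroup ℤ where
  carrier := {t | ShiftInvariant t r}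
  zero_mem' x y := by simp
  add_mem' {s t} hs ht x y := by rw [← add_assoc, ← add_assoc, ht, hs]
  neg_mem' {t} ht x y := by rw [← ht]; simp

lemma ShiftInvariant.mul {t : ℤ} {r : Setoid ℤ} (h : ShiftInvariant t r) (q : ℤ) :
    ShiftInvariant (t * q) r := by
  have := (shiftSubgroup r).zsmul_mem h q
  rwa [smul_eq_mul, mul_comm] at this

section Periodic

lemma card_filter_Ioc_eq_Ico (d : ℕ) (hd : 0 < d) (p : ℤ → Prop) [DecidablePred p]
    (hp : ∀ x, p (x + d) ↔ p x) : #{x ∈ Ioc (0 : ℤ) d | p x} = #{x ∈ Ico (0 : ℤ) d | p x} := by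
  have hp0 := hp 0
  rw [zero_add] at hp0
  have h2 : Ico (0 : ℤ) d = insert 0 (Ioo 0 (d : ℤ)) := by
    ext x; simp only [mem_Ico, mem_insert, mem_Ioo]; lia
  have h3 : Ioc (0 : ℤ) d = insert (d : ℤ) (Ioo 0 (d : ℤ)) := by
    ext x; simp only [mem_Ioc, mem_insert, mem_Ioo]; lia
  rw [h2, h3, filter_insert, filter_insert]
  by_cases h : p 0
  · rw [if_pos h, if_pos (hp0.2 h), card_insert_of_notMem (by simp),
      card_insert_of_notMem (by simp)]
  · rw [if_neg h, if_neg (mt hp0.1 h)]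

lemma height_add_period (A B : Set ℤ) (d : ℕ) (hA : ∀ x : ℤ, x + d ∈ A ↔ x ∈ A)
    (hB : ∀ x : ℤ, x + d ∈ B ↔ x ∈ B) (x : ℤ) :
    height A B (x + d) = height A B x + height A B d := by
  classical
  have hs : ∀ x, heightStep A B (x + d) = heightStep A B x := fun x => by
    simp only [heightStep, Set.indicator, hA, add_right_comm x (d : ℤ) 1, hB]
    rfl
  induction x using Int.induction_on with
  | zero => simp [height_zero]
  | succ i ih =>
    rw [height_succ, add_right_comm, height_succ, ih, hs]
    ring
  | pred i ih =>
    have h1 := height_succ A B (-i - 1)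
    have h2 := height_succ A B (-i - 1 + d)
    have h3 := hs (-i - 1)
    rw [show -(i : ℤ) - 1 + d + 1 = -i + d by ring] at h2
    rw [show -(i : ℤ) - 1 + 1 = -i by ring] at h1
    lia

open scoped Classical in
lemma height_period (A B : Set ℤ) (d : ℕ) (hd : 0 < d)
    (hB : ∀ x : ℤ, x + d ∈ B ↔ x ∈ B) :
    height A B d = #{x ∈ Ico (0 : ℤ) d | x ∈ A} - #{x ∈ Ico (0 : ℤ) d | x ∈ B} := by
  have := height_sub A B (i := 0) (k := d) (by lia)
  rw [height_zero, card_filter_Ioc_eq_Ico d hd (· ∈ B) hB] at this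
  lia

variable {d : ℕ} {r : Setoid ℤ}

lemma ShiftInvariant.mem_openers {t : ℤ} (h : ShiftInvariant t r) (x : ℤ) :
    x + t ∈ openers r ↔ x ∈ openers r := by
  constructor
  · rintro ⟨j, h1, h2⟩
    refine ⟨j - t, by lia, ?_⟩
    rw [← h]
    simpa using h2
  · rintro ⟨j, h1, h2⟩
    exact ⟨j + t, by lia, (h _ _).2 h2⟩

lemma ShiftInvariant.mem_closers {t : ℤ} (h : ShiftInvariant t r) (x : ℤ) :
    x + t ∈ closers r ↔ x ∈ closers r := by
  constructor
  · rintro ⟨j, h1, h2⟩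
    refine ⟨j - t, by lia, ?_⟩
    rw [← h]
    simpa using h2
  · rintro ⟨j, h1, h2⟩
    exact ⟨j + t, by lia, (h _ _).2 h2⟩

lemma ShiftInvariant.next_add {t x : ℤ} (h : ShiftInvariant t r) (hx : x ∈ openers r) :
    next r (x + t) = next r x + t := by
  obtain ⟨h1, h2, h3⟩ := next_spec hx
  refine next_eq (by lia) ((h _ _).2 h2) fun k hk hk' => ?_
  have := h3 (k - t) (by lia) (by rw [← h]; simpa using hk')
  lia

lemma ShiftInvariant.prev_add {t x : ℤ} (h : ShiftInvariant t r) (hx : x ∈ closers r) :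
    prev r (x + t) = prev r x + t := by
  obtain ⟨h1, h2, h3⟩ := prev_spec hx
  refine prev_eq (by lia) ((h _ _).2 h2) fun k hk hk' => ?_
  have := h3 (k - t) (by lia) (by rw [← h]; simpa using hk')
  lia

open scoped Classical in
lemma ShiftInvariant.card_openers_eq (hd : 0 < d) (h : ShiftInvariant d r) :
    #{x ∈ Ico (0 : ℤ) d | x ∈ openers r} = #{x ∈ Ico (0 : ℤ) d | x ∈ closers r} := by
  have hd' : (d : ℤ) ≠ 0 := by lia
  have hmod : ∀ x : ℤ, x % d = x + d * (-(x / d)) := fun x => by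
    have := Int.emod_add_mul_ediv x d
    lia
  have hmem : ∀ x : ℤ, 0 ≤ x % d ∧ x % d < d := fun x =>
    ⟨Int.emod_nonneg _ hd', Int.emod_lt_of_pos _ (by lia)⟩
  refine Finset.card_nbij' (fun x => next r x % d) (fun x => prev r x % d) ?_ ?_ ?_ ?_ <;>
    intro x hx <;>
    simp only [coe_filter, Finset.mem_Ico, Set.mem_ofPred_eq] at hx ⊢
  · refine ⟨hmem _, ?_⟩
    rw [hmod, (h.mul _).mem_closers]
    exact next_mem_closers hx.2
  · refine ⟨hmem _, ?_⟩
    rw [hmod, (h.mul _).mem_openers]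
    exact prev_mem_openers hx.2
  · rw [hmod (next r x), (h.mul _).prev_add (next_mem_closers hx.2), prev_next hx.2,
      Int.add_mul_emod_self_left, Int.emod_eq_of_lt hx.1.1 hx.1.2]
  · rw [hmod (prev r x), (h.mul _).next_add (prev_mem_openers hx.2), next_prev hx.2,
      Int.add_mul_emod_self_left, Int.emod_eq_of_lt hx.1.1 hx.1.2]

lemma card_powerset_pairs (s : Finset ℤ) :
    #{AB ∈ s.powerset ×ˢ s.powerset | #AB.1 = #AB.2} = (2 * #s).choose #s := by
  rw [← Nat.sum_range_choose_sq, Finset.card_eq_sum_card_fiberwise (f := fun AB => #AB.1)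
    (t := range (#s + 1))]
  · refine Finset.sum_congr rfl fun k _ => ?_
    rw [sq, ← Finset.card_powersetCard, ← Finset.card_product]
    congr 1
    ext ⟨A, B⟩
    simp only [mem_filter, mem_product, mem_powerset, mem_powersetCard]
    lia
  · intro AB hAB
    simp only [coe_filter, mem_product, mem_powerset, Set.mem_ofPred_eq] at hAB
    have := card_le_card hAB.1.1
    simp only [coe_range, Set.mem_Iio]
    lia

lemma filter_mod_mem_eq {s : Finset ℤ} (hs : s ⊆ Ico (0 : ℤ) d) :
    {x ∈ Ico (0 : ℤ) d | x % (d : ℤ) ∈ s} = s := by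
  ext x
  simp only [mem_filter]
  constructor
  · rintro ⟨h1, h2⟩
    rw [Finset.mem_Ico] at h1
    rwa [Int.emod_eq_of_lt h1.1 h1.2] at h2
  · intro h
    have h1 := hs h
    refine ⟨h1, ?_⟩
    rw [Finset.mem_Ico] at h1
    rwa [Int.emod_eq_of_lt h1.1 h1.2]

lemma balanced_of_card_eq (hd : 0 < d) {A B : Finset ℤ} (hA : A ⊆ Ico (0 : ℤ) d)
    (hB : B ⊆ Ico (0 : ℤ) d) (h : #A = #B) (x : ℤ) :
    height {x : ℤ | x % d ∈ A} {x : ℤ | x % d ∈ B} (x + d) =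
      height {x : ℤ | x % d ∈ A} {x : ℤ | x % d ∈ B} x := by
  classical
  rw [height_add_period _ _ d (by simp) (by simp), height_period _ _ d hd (by simp)]
  simp only [Set.mem_ofPred_eq]
  rw [filter_mod_mem_eq hA, filter_mod_mem_eq hB, h]
  simp

lemma levelSetoid_shiftInvariant {A B : Set ℤ} {d : ℕ} (hA : ∀ x : ℤ, x + d ∈ A ↔ x ∈ A)
    (hh : ∀ x : ℤ, height A B (x + d) = height A B x) :
    ShiftInvariant d (levelSetoid A B) := by
  have key : ∀ x y : ℤ, SameLevel A B (x + d) (y + d) ↔ SameLevel A B x y := by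
    intro x y
    unfold SameLevel
    rw [hh, hh, add_le_add_iff_right]
    refine and_congr_right fun _ => and_congr_right fun _ =>
      ⟨fun h k h1 h2 => ?_, fun h k h1 h2 => ?_⟩
    · have := h (k + d) (by lia) (by lia)
      rwa [hh, hA, add_lt_add_iff_right] at this
    · have := h (k - d) (by lia) (by lia)
      rw [← hh (k - d), ← hA (k - d), sub_add_cancel] at this
      exact ⟨this.1, fun h3 => this.2 (by lia)⟩
  intro x y
  exact or_congr (key x y) (key y x)

/-- Translation invariant non-crossing equivalence relations on `ℤ`. -/
lemma card_shiftInvariant_nonCrossing (hd : 0 < d) :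
    Nat.card {r : Setoid ℤ // IntNonCrossing r ∧ ShiftInvariant d r} = (2 * d).choose d := by
  classical
  have hmod : ∀ x : ℤ, x = x % d + d * (x / d) := fun x => (Int.emod_add_mul_ediv x d).symm
  have hmem : ∀ x : ℤ, 0 ≤ x % d ∧ x % d < d := fun x =>
    ⟨Int.emod_nonneg _ (by lia), Int.emod_lt_of_pos _ (by lia)⟩
  have hcard := card_powerset_pairs (Ico (0 : ℤ) d)
  rw [Int.card_Ico, sub_zero, Int.toNat_natCast] at hcard
  rw [← hcard, ← Nat.card_eq_finsetCard]
  have hback : ∀ (S : Set ℤ), (∀ (q x : ℤ), x + d * q ∈ S ↔ x ∈ S) →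
      {x : ℤ | x % d ∈ ({x ∈ Ico (0 : ℤ) d | x ∈ S} : Finset ℤ)} = S := fun S hS => by
    ext x
    simp only [mem_filter, Finset.mem_Ico, Set.mem_ofPred_eq, hmem x, true_and]
    nth_rw 2 [hmod x]
    rw [hS]
  have hbal : ∀ A B : Finset ℤ, A ⊆ Ico (0 : ℤ) d → B ⊆ Ico (0 : ℤ) d → #A = #B →
      openers (levelSetoid {x : ℤ | x % d ∈ A} {x : ℤ | x % d ∈ B}) = {x : ℤ | x % d ∈ A} ∧
      closers (levelSetoid {x : ℤ | x % d ∈ A} {x : ℤ | x % d ∈ B}) = {x : ℤ | x % d ∈ B} := by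
    intro A B hA hB h
    have hh := balanced_of_card_eq hd hA hB h
    refine ⟨openers_levelSetoid fun i => ⟨i + d, by lia, (hh i).le⟩,
      closers_levelSetoid fun i => ⟨i - d, by lia, ?_⟩⟩
    have := hh (i - d)
    rw [sub_add_cancel] at this
    exact this.ge
  refine Nat.card_congr
    { toFun := fun r => ⟨({x ∈ Ico (0 : ℤ) d | x ∈ openers r.1},
          {x ∈ Ico (0 : ℤ) d | x ∈ closers r.1}), ?_⟩
      invFun := fun AB =>
        ⟨levelSetoid {x : ℤ | x % d ∈ AB.1.1} {x : ℤ | x % d ∈ AB.1.2},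
          levelSetoid_nonCrossing _ _, ?_⟩
      left_inv := ?_
      right_inv := ?_ }
  · simp only [mem_filter, mem_product, mem_powerset]
    exact ⟨⟨filter_subset _ _, filter_subset _ _⟩, r.2.2.card_openers_eq hd⟩
  · obtain ⟨⟨A, B⟩, hAB⟩ := AB
    simp only [mem_filter, mem_product, mem_powerset] at hAB
    exact levelSetoid_shiftInvariant (by simp) (balanced_of_card_eq hd hAB.1.1 hAB.1.2 hAB.2)
  · rintro ⟨r, hr, hs⟩
    simp only [Subtype.mk.injEq]
    rw [hback _ fun q x => (hs.mul q).mem_openers x, hback _ fun q x => (hs.mul q).mem_closers x,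
      hr.levelSetoid_eq]
  · rintro ⟨⟨A, B⟩, hAB⟩
    simp only [mem_filter, mem_product, mem_powerset] at hAB
    obtain ⟨h1, h2⟩ := hbal A B hAB.1.1 hAB.1.2 hAB.2
    simp only [h1, h2, Set.mem_ofPred_eq, filter_mod_mem_eq hAB.1.1, filter_mod_mem_eq hAB.1.2]

end Periodic

section Dyck

open DyckStep

open scoped Classical in
/-- The `t`-th letter of the Dyck word of a pair of sets of openers and closers: the letter at
`2 * i` tells whether `i` is a closer, the letter at `2 * i + 1` whether `i` is an opener. -/
noncomputable def dyckLetter (A B : Set ℤ) (t : ℕ) : DyckStep :=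
  if Even t then (if ((t / 2 : ℕ) : ℤ) ∈ B then D else U)
  else (if ((t / 2 : ℕ) : ℤ) ∈ A then U else D)

/-- The first `m` letters of the Dyck word of a pair of sets of openers and closers. -/
noncomputable def dyckPrefix (A B : Set ℤ) (m : ℕ) : List DyckStep :=
  (List.range m).map (dyckLetter A B)

open scoped Classical in
lemma dyckPrefix_count {A B : Set ℤ} (h0 : (0 : ℤ) ∉ B) (k : ℕ) :
    ((dyckPrefix A B (2 * k)).count U : ℤ) - (dyckPrefix A B (2 * k)).count D =
      2 * height A B k + 2 * (if (k : ℤ) ∈ B then 1 else 0) ∧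
    ((dyckPrefix A B (2 * k + 1)).count U : ℤ) - (dyckPrefix A B (2 * k + 1)).count D =
      2 * height A B k + 1 := by
  have hsucc : ∀ m, dyckPrefix A B (m + 1) = dyckPrefix A B m ++ [dyckLetter A B m] := fun m => by
    simp [dyckPrefix, List.range_succ]
  have hev : ∀ k : ℕ, dyckLetter A B (2 * k) = if (k : ℤ) ∈ B then D else U := fun k => by
    simp [dyckLetter]
  have hodd : ∀ k : ℕ, dyckLetter A B (2 * k + 1) = if (k : ℤ) ∈ A then U else D := fun k => by
    have : (2 * k + 1) / 2 = k := by lia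
    rw [dyckLetter, if_neg (by simp), this]
  induction k with
  | zero => simp [dyckPrefix, height_zero, dyckLetter, h0]
  | succ k ih =>
    have e1 : ((dyckPrefix A B (2 * (k + 1))).count U : ℤ) - (dyckPrefix A B (2 * (k + 1))).count D =
        2 * height A B (k + 1 : ℕ) + 2 * (if ((k + 1 : ℕ) : ℤ) ∈ B then 1 else 0) := by
      rw [show 2 * (k + 1) = 2 * k + 1 + 1 by ring, hsucc, hodd, List.count_append, List.count_append]
      push_cast
      rw [height_succ]
      rcases heightStep_cases A B k with ⟨h1, h2, h3⟩ | ⟨h1, h2, h3⟩ | ⟨h1, h2, h3⟩ | ⟨h1, h2, h3⟩ <;>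
        simp [h1, h2, h3] <;> lia
    refine ⟨e1, ?_⟩
    rw [hsucc, hev, List.count_append, List.count_append]
    by_cases h : ((k + 1 : ℕ) : ℤ) ∈ B <;> simp only [h, if_true, if_false] at e1 ⊢ <;>
      simp <;> lia

/-- Equivalence relations on `ℤ` for which everything outside of `[0, n)` is a singleton. -/
def SupportedBelow (n : ℕ) (r : Setoid ℤ) : Prop :=
  ∀ x y, r x y → x = y ∨ (0 ≤ x ∧ x < n ∧ 0 ≤ y ∧ y < n)

namespace SupportedBelow

variable {n : ℕ} {r : Setoid ℤ}

lemma of_openers (h : SupportedBelow n r) {x : ℤ} (hx : x ∈ openers r) : 0 ≤ x ∧ x + 1 < n := by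
  obtain ⟨j, h1, h2⟩ := hx
  have := h _ _ h2
  lia

lemma of_closers (h : SupportedBelow n r) {x : ℤ} (hx : x ∈ closers r) : 0 < x ∧ x < n := by
  obtain ⟨j, h1, h2⟩ := hx
  have := h _ _ h2
  lia

lemma height_nonneg (h : SupportedBelow n r) {k : ℤ} (hk : 0 ≤ k) :
    0 ≤ height (openers r) (closers r) k := by
  rw [← height_zero (openers r) (closers r)]
  exact height_le_of_prev hk fun b _ _ h3 => (h.of_openers (prev_mem_openers h3)).1

lemma height_eq_zero (h : SupportedBelow n r) : height (openers r) (closers r) n = 0 := by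
  refine le_antisymm ?_ (h.height_nonneg (by lia))
  rw [← height_zero (openers r) (closers r)]
  exact height_ge_of_next (by lia) fun b _ _ h3 => (h.of_closers (next_mem_closers h3)).2.le

lemma count_eq (h : SupportedBelow n r) :
    (dyckPrefix (openers r) (closers r) (2 * n)).count U =
      (dyckPrefix (openers r) (closers r) (2 * n)).count D := by
  have h0 : (0 : ℤ) ∉ closers r := fun h1 => (h.of_closers h1).1.false
  have hn : (n : ℤ) ∉ closers r := fun h1 => (h.of_closers h1).2.false
  have := (dyckPrefix_count (A := openers r) h0 n).1
  rw [h.height_eq_zero, if_neg hn] at this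
  lia

/-- The Dyck word of an equivalence relation supported in `[0, n)`. -/
noncomputable def toDyckWord (h : SupportedBelow n r) : DyckWord where
  toList := dyckPrefix (openers r) (closers r) (2 * n)
  count_U_eq_count_D := h.count_eq
  count_D_le_count_U i := by
    classical
    have h0 : (0 : ℤ) ∉ closers r := fun h1 => (h.of_closers h1).1.false
    have : (dyckPrefix (openers r) (closers r) (2 * n)).take i =
        dyckPrefix (openers r) (closers r) (min i (2 * n)) := by
      simp [dyckPrefix, ← List.map_take, List.take_range]
    rw [this]
    obtain ⟨k, hk | hk⟩ := Nat.even_or_odd' (min i (2 * n)) <;> rw [hk]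
    · have h1 := (dyckPrefix_count (A := openers r) h0 k).1
      have h2 := h.height_nonneg (k := k) (by lia)
      split_ifs at h1 <;> lia
    · have h1 := (dyckPrefix_count (A := openers r) h0 k).2
      have h2 := h.height_nonneg (k := k) (by lia)
      lia

lemma semilength_toDyckWord (h : SupportedBelow n r) : h.toDyckWord.semilength = n := by
  have := h.toDyckWord.two_mul_semilength_eq_length
  simp only [toDyckWord, dyckPrefix, List.length_map, List.length_range] at this ⊢
  lia

end SupportedBelow

lemma mem_of_dyckLetter_eq {n : ℕ} {A B A' B' : Set ℤ}
    (h : ∀ t < 2 * n, dyckLetter A B t = dyckLetter A' B' t) (k : ℕ) (hk : k < n) :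
    ((k : ℤ) ∈ A ↔ (k : ℤ) ∈ A') ∧ ((k : ℤ) ∈ B ↔ (k : ℤ) ∈ B') := by
  have h1 := h (2 * k) (by lia)
  have h2 := h (2 * k + 1) (by lia)
  have e : (2 * k + 1) / 2 = k := by lia
  simp only [dyckLetter, even_two, Even.mul_right, if_true, Nat.not_even_two_mul_add_one, if_false,
    e, Nat.mul_div_cancel_left k two_pos] at h1 h2
  constructor
  · split_ifs at h2 <;> simp_all
  · split_ifs at h1 <;> simp_all

lemma setoid_eq_of_dyckPrefix_eq {n : ℕ} {r s : Setoid ℤ} (hr : IntNonCrossing r)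
    (hs : IntNonCrossing s) (hr' : SupportedBelow n r) (hs' : SupportedBelow n s)
    (h : dyckPrefix (openers r) (closers r) (2 * n) = dyckPrefix (openers s) (closers s) (2 * n)) :
    r = s := by
  have h' := mem_of_dyckLetter_eq (n := n) (A := openers r) (A' := openers s) (B := closers r)
    (B' := closers s) fun t ht => List.map_inj_left.1 h t (List.mem_range.2 ht)
  have hA : openers r = openers s := by
    ext x
    refine ⟨fun hx => ?_, fun hx => ?_⟩
    · have := hr'.of_openers hx
      lift x to ℕ using this.1
      exact (h' x (by lia)).1.1 hx
    · have := hs'.of_openers hx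
      lift x to ℕ using this.1
      exact (h' x (by lia)).1.2 hx
  have hB : closers r = closers s := by
    ext x
    refine ⟨fun hx => ?_, fun hx => ?_⟩
    · have := hr'.of_closers hx
      lift x to ℕ using this.1.le
      exact (h' x (by lia)).2.1 hx
    · have := hs'.of_closers hx
      lift x to ℕ using this.1.le
      exact (h' x (by lia)).2.2 hx
  rw [← hr.levelSetoid_eq, ← hs.levelSetoid_eq, hA, hB]

lemma height_eq_of_forall_notMem {A B : Set ℤ} {i k : ℤ} (hik : i ≤ k)
    (hA : ∀ x, i ≤ x → x < k → x ∉ A) (hB : ∀ x, i < x → x ≤ k → x ∉ B) :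
    height A B k = height A B i := by
  classical
  have h := height_sub A B hik
  rw [Finset.filter_false_of_mem fun x hx => hA x (mem_Ico.1 hx).1 (mem_Ico.1 hx).2,
    Finset.filter_false_of_mem fun x hx => hB x (mem_Ioc.1 hx).1 (mem_Ioc.1 hx).2] at h
  simp only [card_empty] at h
  lia

lemma exists_supportedBelow_of_dyckWord (p : DyckWord) :
    ∃ r : Setoid ℤ, IntNonCrossing r ∧ SupportedBelow p.semilength r ∧
      dyckPrefix (openers r) (closers r) (2 * p.semilength) = p.toList := by
  classical
  set n := p.semilength with hn
  have hlen : p.toList.length = 2 * n := p.two_mul_semilength_eq_length.symm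
  let A : Set ℤ := {x | 0 ≤ x ∧ p.toList[(2 * x + 1).toNat]? = some U}
  let B : Set ℤ := {x | 0 ≤ x ∧ p.toList[(2 * x).toNat]? = some D}
  have hA : ∀ x ∈ A, 0 ≤ x ∧ x < n := fun x hx => by
    obtain ⟨hl, -⟩ := List.getElem?_eq_some_iff.1 hx.2
    exact ⟨hx.1, by lia⟩
  have hB : ∀ x ∈ B, 0 ≤ x ∧ x < n := fun x hx => by
    obtain ⟨hl, -⟩ := List.getElem?_eq_some_iff.1 hx.2
    exact ⟨hx.1, by lia⟩
  have h0 : (0 : ℤ) ∉ B := fun hx => by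
    have h1 := hx.2
    have h2 := p.count_D_le_count_U 1
    rw [List.take_one] at h2
    simp only [mul_zero, Int.toNat_zero, ← List.head?_eq_getElem?] at h1
    simp [h1] at h2
  have hlist : dyckPrefix A B (2 * n) = p.toList := by
    refine List.ext_getElem (by simp [dyckPrefix, hlen]) fun t h1 h2 => ?_
    simp only [dyckPrefix, List.getElem_map, List.getElem_range]
    obtain ⟨k, hk | hk⟩ := Nat.even_or_odd' t
    · have e : ((k : ℤ) ∈ B) ↔ p.toList[t] = D := by
        have : (2 * (k : ℤ)).toNat = t := by lia
        simp [B, this, h2]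
      have e2 : t / 2 = k := by lia
      rw [dyckLetter, if_pos (by simp [hk]), e2]
      split_ifs with h
      · exact (e.1 h).symm
      · exact ((DyckStep.dichotomy _).resolve_right (mt e.2 h)).symm
    · have e : ((k : ℤ) ∈ A) ↔ p.toList[t] = U := by
        have : (2 * (k : ℤ) + 1).toNat = t := by lia
        simp [A, this, h2]
      have e2 : t / 2 = k := by lia
      rw [dyckLetter, if_neg (by simp [hk]), e2]
      split_ifs with h
      · exact (e.1 h).symm
      · exact ((DyckStep.dichotomy _).resolve_left (mt e.2 h)).symm
  have hpre : ∀ m ≤ 2 * n, dyckPrefix A B m = p.toList.take m := fun m hm => by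
    rw [← hlist, dyckPrefix, dyckPrefix, ← List.map_take, List.take_range, min_eq_left hm]
  have hn0 : height A B n = 0 := by
    have h1 := (dyckPrefix_count (A := A) h0 n).1
    rw [if_neg fun h => (hB _ h).2.false, hlist, p.count_U_eq_count_D] at h1
    lia
  have hbig : ∀ k : ℤ, n ≤ k → height A B k = 0 := fun k hk => by
    rw [height_eq_of_forall_notMem hk (fun x hx _ h => ?_) fun x hx _ h => ?_, hn0]
    · have := hA x h
      lia
    · have := hB x h
      lia
  have hsmall : ∀ k : ℤ, k ≤ 0 → height A B k = 0 := fun k hk => by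
    rw [← height_eq_of_forall_notMem hk (fun x _ hx h => ?_) fun x _ hx h => ?_, height_zero]
    · have := hA x h
      lia
    · have := hB x h
      obtain rfl : x = 0 := by lia
      exact h0 h
  have hnonneg : ∀ k : ℤ, 0 ≤ height A B k := fun k => by
    rcases le_or_gt k 0 with hk | hk
    · exact (hsmall k hk).ge
    rcases le_or_gt (n : ℤ) k with hk' | hk'
    · exact (hbig k hk').ge
    lift k to ℕ using hk.le
    have h1 := (dyckPrefix_count (A := A) h0 k).2
    rw [hpre _ (by lia)] at h1
    have := p.count_D_le_count_U (2 * k + 1)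
    lia
  have hop : openers (levelSetoid A B) = A := openers_levelSetoid fun i =>
    ⟨max n (i + 1), by lia, by rw [hbig _ (le_max_left _ _)]; exact hnonneg _⟩
  have hcl : closers (levelSetoid A B) = B := closers_levelSetoid fun i =>
    ⟨min 0 (i - 1), by lia, by rw [hsmall _ (min_le_left _ _)]; exact hnonneg _⟩
  refine ⟨levelSetoid A B, levelSetoid_nonCrossing A B, fun x y hxy => ?_, by rw [hop, hcl, hlist]⟩
  rcases lt_trichotomy x y with h | h | h
  · have h1 := hA x (hop ▸ ⟨y, h, hxy⟩)
    have h2 := hB y (hcl ▸ ⟨x, h, hxy⟩)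
    exact Or.inr ⟨h1.1, h1.2, h2.1, h2.2⟩
  · exact Or.inl h
  · have h1 := hA y (hop ▸ ⟨x, h, Setoid.symm' _ hxy⟩)
    have h2 := hB x (hcl ▸ ⟨y, h, Setoid.symm' _ hxy⟩)
    exact Or.inr ⟨h2.1, h2.2, h1.1, h1.2⟩

lemma card_supportedBelow_nonCrossing (n : ℕ) :
    Nat.card {r : Setoid ℤ // IntNonCrossing r ∧ SupportedBelow n r} = catalan n := by
  rw [← DyckWord.card_dyckWord_semilength_eq_catalan, ← Nat.card_eq_fintype_card]
  refine Nat.card_eq_of_bijective (fun r => ⟨r.2.2.toDyckWord, r.2.2.semilength_toDyckWord⟩)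
    ⟨?_, ?_⟩
  · rintro ⟨r, hr, hr'⟩ ⟨s, hs, hs'⟩ h
    exact Subtype.ext (setoid_eq_of_dyckPrefix_eq hr hs hr' hs'
      (congrArg (fun p => p.1.toList) h))
  · rintro ⟨p, rfl⟩
    obtain ⟨r, h1, h2, h3⟩ := exists_supportedBelow_of_dyckWord p
    exact ⟨⟨r, h1, h2⟩, Subtype.ext (DyckWord.ext h3)⟩

end Dyck

/-- Non-crossing equivalence relations on `ℤ / n`, seen as relations on `ℤ`. -/
structure CyclicNonCrossing (n : ℕ) (p : Setoid ℤ) : Prop where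
  rel_add : ∀ x : ℤ, p x (x + n)
  nonCrossing : ∀ x y z w : ℤ, x < y → y < z → z < w → w < x + n → p x z → p y w → p x y

section Cyclic

variable {n d : ℕ} {p r : Setoid ℤ}

lemma ShiftInvariant.rel_of_rel_add {x y : ℤ} (hs : ShiftInvariant d r) (hxy : r x y)
    (hx : r x (x + d)) : r y (y + d) :=
  r.trans' (r.symm' hxy) (r.trans' hx ((hs x y).2 hxy))

lemma ShiftInvariant.rel_add_mul {x : ℤ} (hs : ShiftInvariant d r) (hx : r x (x + d)) (q : ℤ) :
    r x (x + d * q) := by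
  induction q using Int.induction_on with
  | zero => simp
  | succ i ih =>
    have := r.trans' ih (hs.rel_of_rel_add ih hx)
    rwa [show x + d * (i : ℤ) + d = x + d * (i + 1) by ring] at this
  | pred i ih =>
    have := (hs (x + d * (-i - 1)) x).1 (by
      rw [show x + d * (-i - 1 : ℤ) + d = x + d * (-i) by ring]
      exact r.trans' (r.symm' ih) hx)
    exact r.symm' this

namespace CyclicNonCrossing

lemma shiftInvariant (hp : CyclicNonCrossing n p) : ShiftInvariant n p := fun x y =>
  ⟨fun h => p.trans' (hp.rel_add x) (p.trans' h (p.symm' (hp.rel_add y))),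
    fun h => p.trans' (p.symm' (hp.rel_add x)) (p.trans' h (hp.rel_add y))⟩

lemma rel_add_mul (hp : CyclicNonCrossing n p) (x q : ℤ) : p x (x + n * q) :=
  hp.shiftInvariant.rel_add_mul (hp.rel_add x) q

lemma rel_add_of_chain (hp : CyclicNonCrossing n p) (hs : ShiftInvariant d p) (hn : 2 * d ≤ n)
    {x y z : ℤ} (hxy : p x y) (hyz : p y z) (h1 : |x - y| < d) (h2 : |y - z| < d)
    (h3 : x + d ≤ z) : p x (x + d) := by
  have hxz := p.trans' hxy hyz
  rw [abs_lt] at h1 h2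
  rcases eq_or_lt_of_le h3 with h3 | h3
  · rwa [h3]
  · exact hp.nonCrossing x (x + d) z (y + d) (by lia) h3 (by lia) (by lia) hxz ((hs x y).2 hxy)

/-- The lift to `ℤ` of an equivalence relation on `ℤ / n` invariant under translation by `d`. -/
def unroll (hp : CyclicNonCrossing n p) (hs : ShiftInvariant d p) (hd : 0 < d) (hn : 2 * d ≤ n) :
    Setoid ℤ where
  r x y := p x y ∧ (|x - y| < d ∨ p x (x + d))
  iseqv := by
    refine ⟨fun x => ⟨p.refl' x, Or.inl (by simpa using hd)⟩, ?_, ?_⟩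
    · rintro x y ⟨h1, h2⟩
      refine ⟨p.symm' h1, h2.imp (fun h => by rwa [abs_sub_comm]) (hs.rel_of_rel_add h1)⟩
    · rintro x y z ⟨h1, h2⟩ ⟨h3, h4⟩
      refine ⟨p.trans' h1 h3, ?_⟩
      by_contra! h
      rcases h2 with h2 | h2
      swap
      · exact h.2 h2
      rcases h4 with h4 | h4
      swap
      · exact h.2 (hs.rel_of_rel_add (p.symm' h1) h4)
      rcases le_abs.1 h.1 with h5 | h5
      · refine h.2 (hs.rel_of_rel_add (p.symm' (p.trans' h1 h3)) ?_)
        rw [abs_sub_comm] at h2 h4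
        exact hp.rel_add_of_chain hs hn (p.symm' h3) (p.symm' h1) h4 h2 (by lia)
      · exact h.2 (hp.rel_add_of_chain hs hn h1 h3 h2 h4 (by lia))

lemma unroll_nonCrossing (hp : CyclicNonCrossing n p) (hs : ShiftInvariant d p) (hd : 0 < d)
    (hn : 2 * d ≤ n) : IntNonCrossing (hp.unroll hs hd hn) := by
  rintro a b c e hab hbc hce ⟨h1, h2⟩ ⟨h3, h4⟩
  suffices h : p a b from ⟨h, h2.imp (fun h => by rw [abs_lt] at h ⊢; lia) id⟩
  by_cases ha : p a (a + d)
  · by_cases hb : p b (b + d)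
    · set q := (b - a) / d with hq
      have hmod := Int.emod_add_mul_ediv (b - a) d
      have hlt := Int.emod_lt_of_pos (b - a) (b := d) (by lia)
      have hnn := Int.emod_nonneg (b - a) (b := d) (by lia)
      rw [← hq] at hmod
      have ha' := hs.rel_add_mul ha q
      rcases eq_or_lt_of_le hnn with h0 | h0
      · rwa [show a + d * q = b by lia] at ha'
      · exact p.trans' ha' (hp.nonCrossing (a + d * q) b (a + d * q + d) (b + d) (by lia) (by lia)
          (by lia) (by lia) (hs.rel_of_rel_add ha' ha) hb)
    · have h4 := h4.resolve_right hb
      rw [abs_lt] at h4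
      exact p.trans' h1 (p.symm' (hp.nonCrossing b c e (c + d) hbc hce (by lia) (by lia) h3
        (hs.rel_of_rel_add h1 ha)))
  · have h2 := h2.resolve_right ha
    rw [abs_lt] at h2
    by_cases hb : p b (b + d)
    · exact hp.nonCrossing a b c (b + d) hab hbc (by lia) (by lia) h1 hb
    · have h4 := h4.resolve_right hb
      rw [abs_lt] at h4
      exact hp.nonCrossing a b c e hab hbc hce (by lia) h1 h3

lemma unroll_shiftInvariant (hp : CyclicNonCrossing n p) (hs : ShiftInvariant d p) (hd : 0 < d)
    (hn : 2 * d ≤ n) : ShiftInvariant d (hp.unroll hs hd hn) := by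
  intro x y
  change p _ _ ∧ (_ ∨ p _ _) ↔ p _ _ ∧ (_ ∨ p _ _)
  rw [hs, hs, add_sub_add_right_eq_sub]

end CyclicNonCrossing

lemma ShiftInvariant.mul_of_dvd (hs : ShiftInvariant d r) (hdn : d ∣ n) (k : ℤ) :
    ShiftInvariant (n * k) r := by
  obtain ⟨m, rfl⟩ := hdn
  have := hs.mul (m * k)
  rwa [← mul_assoc, ← Nat.cast_mul] at this

/-- The relation on `ℤ / n` obtained from a relation on `ℤ` invariant under translation by `n`. -/
def ShiftInvariant.roll (hs : ShiftInvariant d r) (hdn : d ∣ n) : Setoid ℤ where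
  r x y := ∃ k : ℤ, r x (y + n * k)
  iseqv := by
    refine ⟨fun x => ⟨0, by simp⟩, ?_, ?_⟩
    · rintro x y ⟨k, h⟩
      refine ⟨-k, ?_⟩
      rw [← hs.mul_of_dvd hdn k, mul_neg, neg_add_cancel_right]
      exact r.symm' h
    · rintro x y z ⟨k, h⟩ ⟨l, h'⟩
      refine ⟨l + k, r.trans' h ?_⟩
      rw [mul_add, ← add_assoc, hs.mul_of_dvd hdn k]
      exact h'

lemma IntNonCrossing.rel_add_of_le (hr : IntNonCrossing r) (hs : ShiftInvariant d r) (hd : 0 < d)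
    {x y : ℤ} (hxy : r x y) (h : (d : ℤ) ≤ |x - y|) : r x (x + d) := by
  have key : ∀ x y, r x y → x + d ≤ y → r x (x + d) := by
    intro x y hxy h
    rcases eq_or_lt_of_le h with rfl | h
    · exact hxy
    · exact hr x (x + d) y (y + d) (by lia) h (by lia) hxy ((hs x y).2 hxy)
  rcases le_abs.1 h with h | h
  · exact hs.rel_of_rel_add (r.symm' hxy) (key y x (r.symm' hxy) (by lia))
  · exact key x y hxy (by lia)

lemma IntNonCrossing.rel_of_rel_add_mul (hr : IntNonCrossing r) (hs : ShiftInvariant d r)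
    (hd : 0 < d) (hdn : d ∣ n) {x y k : ℤ} (h : r x (y + n * k))
    (hk : (d : ℤ) ≤ |x - (y + n * k)|) : r x y := by
  obtain ⟨m, rfl⟩ := hdn
  have h1 := hs.rel_of_rel_add h (hr.rel_add_of_le hs hd h hk)
  have h2 := hs.rel_add_mul h1 (-(m * k))
  rw [Nat.cast_mul, mul_assoc, mul_neg, add_neg_cancel_right, ← mul_assoc, ← Nat.cast_mul] at h2
  exact r.trans' h h2

lemma IntNonCrossing.rel_or_rel_sub (hr : IntNonCrossing r) (hs : ShiftInvariant d r)
    (hd : 0 < d) (hdn : d ∣ n) (hn : 2 * d ≤ n) {x z : ℤ} (h : hs.roll hdn x z) (hxz : x < z)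
    (hzx : z < x + n) : r x z ∨ r x (z - n) := by
  obtain ⟨k, h⟩ := h
  by_cases hk : (d : ℤ) ≤ |x - (z + n * k)|
  · exact Or.inl (hr.rel_of_rel_add_mul hs hd hdn h hk)
  · rw [not_le, abs_lt] at hk
    have h1 : -2 < k := by
      by_contra! hk'
      have : (n : ℤ) * k ≤ n * (-2) := by gcongr
      lia
    have h2 : k < 1 := by
      by_contra! hk'
      have : (n : ℤ) * 1 ≤ n * k := by gcongr
      lia
    obtain rfl | rfl : k = 0 ∨ k = -1 := by lia
    · exact Or.inl (by simpa using h)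
    · exact Or.inr (by simpa [sub_eq_add_neg] using h)

lemma IntNonCrossing.roll_nonCrossing (hr : IntNonCrossing r) (hs : ShiftInvariant d r)
    (hd : 0 < d) (hdn : d ∣ n) (hn : 2 * d ≤ n) : CyclicNonCrossing n (hs.roll hdn) where
  rel_add x := ⟨-1, by simp⟩
  nonCrossing x y z w hxy hyz hzw hwx h1 h2 := by
    have hsn : ∀ x y, r (x + n) (y + n) ↔ r x y := by
      have := hs.mul_of_dvd hdn 1
      rwa [mul_one] at this
    have of_rel : r x y → hs.roll hdn x y := fun h => ⟨0, by simpa using h⟩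
    rcases hr.rel_or_rel_sub hs hd hdn hn h1 (by lia) (by lia) with h1 | h1 <;>
    rcases hr.rel_or_rel_sub hs hd hdn hn h2 (by lia) (by lia) with h2 | h2
    · exact of_rel (hr x y z w hxy hyz hzw h1 h2)
    · refine of_rel (r.symm' (r.trans' h2 (hr (w - n) x y z (by lia) hxy hyz (r.symm' h2) h1)))
    · rw [← hsn, sub_add_cancel] at h1
      refine ⟨-1, ?_⟩
      rw [← hsn, mul_neg, mul_one, neg_add_cancel_right]
      exact r.trans' h1 (r.symm' (hr y z w (x + n) hyz hzw hwx h2 (r.symm' h1)))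
    · exact of_rel (r.trans' h1 (r.trans' (hr (z - n) (w - n) x y (by lia) (by lia) hxy
        (r.symm' h1) (r.symm' h2)) (r.symm' h2)))

lemma IntNonCrossing.roll_shiftInvariant (hs : ShiftInvariant d r) (hdn : d ∣ n) :
    ShiftInvariant d (hs.roll hdn) := by
  intro x y
  refine exists_congr fun k => ?_
  rw [add_right_comm, hs]

lemma CyclicNonCrossing.roll_unroll (hp : CyclicNonCrossing n p) (hs : ShiftInvariant d p)
    (hd : 0 < d) (hdn : d ∣ n) (hn : 2 * d ≤ n) :
    (hp.unroll_shiftInvariant hs hd hn).roll hdn = p := by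
  ext x y
  constructor
  · rintro ⟨k, h, -⟩
    exact p.trans' h (p.symm' (hp.rel_add_mul y k))
  · intro h
    by_cases hx : p x (x + d)
    · exact ⟨0, by simpa using h, Or.inr hx⟩
    have hmod := Int.emod_add_mul_ediv (y - x) n
    have hlt := Int.emod_lt_of_pos (y - x) (b := n) (by lia)
    have hnn := Int.emod_nonneg (y - x) (b := n) (by lia)
    set q := (y - x) / n
    have hy : ∀ k, p x (y + n * k) := fun k => p.trans' h (hp.rel_add_mul y k)
    by_cases h1 : (y - x) % n < d
    · exact ⟨-q, hy _, Or.inl (by rw [abs_lt]; lia)⟩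
    by_cases h2 : (n : ℤ) - d < (y - x) % n
    · refine ⟨-q - 1, hy _, Or.inl ?_⟩
      rw [abs_lt, mul_sub]
      lia
    exfalso
    have h3 := hy (-q)
    set z := y + n * -q with hz
    rcases eq_or_lt_of_le (by lia : x + d ≤ z) with h4 | h4
    · rw [← h4] at h3
      exact hx h3
    rcases eq_or_lt_of_le (by lia : z ≤ x + n - d) with h5 | h5
    · have := (hs _ _).2 h3
      rw [h5, sub_add_cancel] at this
      exact hx (p.symm' (p.trans' this (p.symm' (hp.rel_add x))))
    · exact hx (hp.nonCrossing x (x + d) z (z + d) (by lia) h4 (by lia) (by lia) h3 ((hs _ _).2 h3))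

lemma IntNonCrossing.unroll_roll (hr : IntNonCrossing r) (hs : ShiftInvariant d r)
    (hd : 0 < d) (hdn : d ∣ n) (hn : 2 * d ≤ n) :
    (hr.roll_nonCrossing hs hd hdn hn).unroll (IntNonCrossing.roll_shiftInvariant hs hdn) hd hn
      = r := by
  ext x y
  have hbig : ∀ k : ℤ, k ≠ 0 → (n : ℤ) ≤ |n * k| := fun k hk => by
    rw [abs_mul, Nat.abs_cast]
    exact le_mul_of_one_le_right (by lia) (Int.one_le_abs hk)
  constructor
  · rintro ⟨⟨k, hk⟩, h⟩
    by_cases h1 : (d : ℤ) ≤ |x - (y + n * k)|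
    · exact hr.rel_of_rel_add_mul hs hd hdn hk h1
    by_cases hk0 : k = 0
    · simpa [hk0] using hk
    have hkn := hbig k hk0
    rcases h with h | ⟨l, hl⟩
    · rw [not_le, abs_lt] at h1
      rw [abs_lt] at h
      rw [le_abs] at hkn
      lia
    · have h2 : (d : ℤ) ≤ |x - (x + d + n * l)| := by
        by_cases hl0 : l = 0
        · simp [hl0]
        · have := hbig l hl0
          rw [le_abs] at this ⊢
          lia
      obtain ⟨m, rfl⟩ := hdn
      have h3 := hs.rel_add_mul (hs.rel_of_rel_add hk (hr.rel_add_of_le hs hd hl h2)) (-(m * k))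
      rw [Nat.cast_mul, mul_assoc, mul_neg, add_neg_cancel_right, ← mul_assoc,
        ← Nat.cast_mul] at h3
      exact r.trans' hk h3
  · intro h
    refine ⟨⟨0, by simpa using h⟩, ?_⟩
    by_cases h1 : (d : ℤ) ≤ |x - y|
    · exact Or.inr ⟨0, by simpa using hr.rel_add_of_le hs hd h h1⟩
    · exact Or.inl (not_le.1 h1)

lemma card_shiftInvariant_cyclicNonCrossing (hd : 0 < d) (hdn : d ∣ n) (hn : 2 * d ≤ n) :
    Nat.card {p : Setoid ℤ // CyclicNonCrossing n p ∧ ShiftInvariant d p} = (2 * d).choose d := by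
  rw [← card_shiftInvariant_nonCrossing hd]
  exact Nat.card_congr
    { toFun := fun p => ⟨p.2.1.unroll p.2.2 hd hn, p.2.1.unroll_nonCrossing p.2.2 hd hn,
        p.2.1.unroll_shiftInvariant p.2.2 hd hn⟩
      invFun := fun r => ⟨r.2.2.roll hdn, r.2.1.roll_nonCrossing r.2.2 hd hdn hn,
        IntNonCrossing.roll_shiftInvariant r.2.2 hdn⟩
      left_inv := fun p => Subtype.ext (p.2.1.roll_unroll p.2.2 hd hdn hn)
      right_inv := fun r => Subtype.ext (r.2.1.unroll_roll r.2.2 hd hdn hn) }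

lemma CyclicNonCrossing.shiftInvariant_iff_gcd {p : Setoid ℤ} (hp : CyclicNonCrossing n p) {t : ℕ} :
    ShiftInvariant t p ↔ ShiftInvariant (n.gcd t) p := by
  constructor
  · intro h
    rw [← Int.gcd_natCast_natCast, Int.gcd_eq_gcd_ab]
    exact (shiftSubgroup p).add_mem (hp.shiftInvariant.mul _) (h.mul _)
  · intro h
    obtain ⟨q, hq⟩ := Nat.gcd_dvd_right n t
    have := h.mul q
    rwa [← Nat.cast_mul, ← hq] at this

end Cyclic

/-- Non-crossing equivalence relations on `{0, …, n - 1}`. -/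
def FinNonCrossing {n : ℕ} (s : Setoid (Fin n)) : Prop :=
  ∀ a b c d, a < b → b < c → c < d → s a c → s b d → s a b

section Fin

variable {n : ℕ}

/-- The embedding of `{0, …, n - 1}` in the integers. -/
def finToInt (i : Fin n) : ℤ := (i : ℕ)

lemma finToInt_nonneg (i : Fin n) : 0 ≤ finToInt i := Nat.cast_nonneg _

lemma finToInt_lt (i : Fin n) : finToInt i < n := Nat.cast_lt.2 i.2

lemma CyclicNonCrossing.finNonCrossing {p : Setoid ℤ} (hp : CyclicNonCrossing n p) :
    FinNonCrossing (p.comap (finToInt (n := n))) := fun a b c d hab hbc hcd =>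
  hp.nonCrossing _ _ _ _ (Nat.cast_lt.2 hab) (Nat.cast_lt.2 hbc) (Nat.cast_lt.2 hcd)
    (by have := finToInt_nonneg a; have := finToInt_lt d; lia)

lemma card_finNonCrossing (n : ℕ) :
    Nat.card {s : Setoid (Fin n) // FinNonCrossing s} = catalan n := by
  rw [← card_supportedBelow_nonCrossing]
  have hinj : Function.Injective (finToInt (n := n)) := fun i j h =>
    Fin.ext (Nat.cast_injective h)
  symm
  refine Nat.card_eq_of_bijective (fun r => ⟨r.1.comap finToInt, fun a b c d hab hbc hcd =>
    r.2.1 _ _ _ _ (Nat.cast_lt.2 hab) (Nat.cast_lt.2 hbc) (Nat.cast_lt.2 hcd)⟩) ⟨?_, ?_⟩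
  · rintro ⟨r, _, hr⟩ ⟨s, _, hs⟩ h
    have key : ∀ i j : Fin n, r (finToInt i) (finToInt j) ↔ s (finToInt i) (finToInt j) := fun i j =>
      by
      have := congrArg Subtype.val h
      exact iff_of_eq (congrArg (fun t : Setoid (Fin n) => t i j) this)
    refine Subtype.ext (Setoid.ext fun x y => ?_)
    have lift : ∀ z : ℤ, 0 ≤ z → z < n → ∃ i : Fin n, finToInt i = z := fun z h0 h1 =>
      ⟨⟨z.toNat, by lia⟩, Int.toNat_of_nonneg h0⟩
    constructor <;> intro hxy
    · rcases hr x y hxy with rfl | ⟨h1, h2, h3, h4⟩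
      · exact s.refl' x
      · obtain ⟨i, rfl⟩ := lift x h1 h2
        obtain ⟨j, rfl⟩ := lift y h3 h4
        exact (key i j).1 hxy
    · rcases hs x y hxy with rfl | ⟨h1, h2, h3, h4⟩
      · exact r.refl' x
      · obtain ⟨i, rfl⟩ := lift x h1 h2
        obtain ⟨j, rfl⟩ := lift y h3 h4
        exact (key i j).2 hxy
  · rintro ⟨s, hs⟩
    let r : Setoid ℤ :=
      { r := fun x y => x = y ∨ ∃ i j, finToInt i = x ∧ finToInt j = y ∧ s i j
        iseqv := by
          refine ⟨fun x => Or.inl rfl, ?_, ?_⟩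
          · rintro x y (rfl | ⟨i, j, rfl, rfl, h⟩)
            · exact Or.inl rfl
            · exact Or.inr ⟨j, i, rfl, rfl, s.symm' h⟩
          · rintro x y z (rfl | ⟨i, j, rfl, rfl, h⟩) h2
            · exact h2
            · rcases h2 with rfl | ⟨k, l, hk, rfl, h2⟩
              · exact Or.inr ⟨i, j, rfl, rfl, h⟩
              · rw [hinj hk] at h2
                exact Or.inr ⟨i, l, rfl, rfl, s.trans' h h2⟩ }
    refine ⟨⟨r, ?_, ?_⟩, Subtype.ext (Setoid.ext fun i j => ?_)⟩
    · rintro a b c d hab hbc hcd (rfl | ⟨i, j, rfl, rfl, h⟩) h2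
      · exact absurd (hab.trans hbc) (lt_irrefl _)
      · rcases h2 with rfl | ⟨k, l, rfl, rfl, h2⟩
        · exact absurd (hbc.trans hcd) (lt_irrefl _)
        · exact Or.inr ⟨i, k, rfl, rfl, hs _ _ _ _ (Nat.cast_lt.1 hab) (Nat.cast_lt.1 hbc)
            (Nat.cast_lt.1 hcd) h h2⟩
    · rintro x y (rfl | ⟨i, j, rfl, rfl, h⟩)
      · exact Or.inl rfl
      · exact Or.inr ⟨finToInt_nonneg i, finToInt_lt i, finToInt_nonneg j, finToInt_lt j⟩
    · constructor
      · rintro (h | ⟨k, l, hk, hl, h⟩)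
        · rw [hinj h]
        · rwa [← hinj hk, ← hinj hl]
      · exact fun h => Or.inr ⟨i, j, rfl, rfl, h⟩

variable [NeZero n]

/-- Reduction modulo `n`. -/
def intToFin (n : ℕ) [NeZero n] (x : ℤ) : Fin n :=
  ⟨(x % n).toNat, by
    have := Int.emod_lt_of_pos x (b := n) (by have := NeZero.pos n; lia)
    have := NeZero.pos n
    lia⟩

lemma finToInt_intToFin (x : ℤ) : finToInt (intToFin n x) = x % n :=
  Int.toNat_of_nonneg (Int.emod_nonneg x (Nat.cast_ne_zero.2 (NeZero.ne n)))

lemma intToFin_finToInt (i : Fin n) : intToFin n (finToInt i) = i := by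
  apply Fin.ext
  change ((((i : ℕ) : ℤ) % (n : ℕ)).toNat) = (i : ℕ)
  rw [← Int.natCast_mod, Int.toNat_natCast, Nat.mod_eq_of_lt i.2]

lemma intToFin_eq_iff {x y : ℤ} : intToFin n x = intToFin n y ↔ x % n = y % n := by
  refine ⟨fun h => ?_, fun h => ?_⟩
  · rw [← finToInt_intToFin, h, finToInt_intToFin]
  · rw [← intToFin_finToInt (intToFin n x), ← intToFin_finToInt (intToFin n y), finToInt_intToFin,
      finToInt_intToFin, h]

lemma FinNonCrossing.cyclicNonCrossing {s : Setoid (Fin n)} (hs : FinNonCrossing s) :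
    CyclicNonCrossing n (s.comap (intToFin n)) where
  rel_add x := by
    rw [Setoid.comap_rel, intToFin_eq_iff.2 (Int.add_emod_right x n).symm]
  nonCrossing := by
    set p := s.comap (intToFin n)
    have h0 : ∀ a b c d : ℤ, 0 ≤ a → a < b → b < c → c < d → d < n → p a c → p b d → p a b := by
      intro a b c d ha hab hbc hcd hd
      refine hs _ _ _ _ ?_ ?_ ?_ <;> rw [Fin.lt_def, ← Nat.cast_lt (α := ℤ)] <;>
      · change finToInt _ < finToInt _
        rw [finToInt_intToFin, finToInt_intToFin, Int.emod_eq_of_lt (by lia) (by lia),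
          Int.emod_eq_of_lt (by lia) (by lia)]
        assumption
    have hred : ∀ x q : ℤ, intToFin n (x - n * q) = intToFin n x := fun x q =>
      intToFin_eq_iff.2 (Int.sub_mul_emod_self_left x n q)
    have hsub : ∀ x y q : ℤ, p (x - n * q) y ↔ p x y := fun x y q => by
      simp only [Setoid.comap_rel, hred]
    have hsub' : ∀ x y q : ℤ, p x (y - n * q) ↔ p x y := fun x y q => by
      simp only [Setoid.comap_rel, hred]
    have h1 : ∀ x y z w : ℤ, 0 ≤ x → x < n → x < y → y < z → z < w → w < x + n → p x z → p y w →
        p x y := by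
      intro x y z w hx0 hxn hxy hyz hzw hwx hxz hyw
      by_cases hw : w < n
      · exact h0 x y z w hx0 hxy hyz hzw hw hxz hyw
      by_cases hz : z < n
      · have := h0 (w - n * 1) x y z (by lia) (by lia) hxy hyz hz
          ((hsub _ _ _).2 (p.symm' hyw)) hxz
        rw [hsub] at this
        exact p.trans' (p.symm' this) (p.symm' hyw)
      by_cases hy : y < n
      · have := h0 (z - n * 1) (w - n * 1) x y (by lia) (by lia) (by lia) hxy hy
          ((hsub _ _ _).2 (p.symm' hxz)) ((hsub _ _ _).2 (p.symm' hyw))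
        rw [hsub, hsub'] at this
        exact p.trans' hxz (p.trans' this (p.symm' hyw))
      · have := h0 (y - n * 1) (z - n * 1) (w - n * 1) x (by lia) (by lia) (by lia) (by lia) hxn
          ((hsub _ _ _).2 ((hsub' _ _ _).2 hyw)) ((hsub _ _ _).2 (p.symm' hxz))
        rw [hsub, hsub'] at this
        exact p.trans' hxz (p.symm' this)
    intro x y z w hxy hyz hzw hwx hxz hyw
    have hn : (0 : ℤ) < n := by have := NeZero.pos n; lia
    have hmod := Int.emod_add_mul_ediv x n
    have hlt := Int.emod_lt_of_pos x hn
    have hnn := Int.emod_nonneg x hn.ne'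
    set q := x / n
    have := h1 (x - n * q) (y - n * q) (z - n * q) (w - n * q) (by lia) (by lia) (by lia) (by lia)
      (by lia) (by lia) ((hsub _ _ _).2 ((hsub' _ _ _).2 hxz)) ((hsub _ _ _).2 ((hsub' _ _ _).2 hyw))
    rwa [hsub, hsub'] at this

lemma comap_intToFin_comap_finToInt (s : Setoid (Fin n)) :
    (s.comap (intToFin n)).comap finToInt = s :=
  Setoid.ext fun i j => by
    rw [Setoid.comap_rel, Setoid.comap_rel, intToFin_finToInt, intToFin_finToInt]

lemma CyclicNonCrossing.comap_finToInt_comap_intToFin {p : Setoid ℤ}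
    (hp : CyclicNonCrossing n p) : (p.comap finToInt).comap (intToFin n) = p := by
  ext x y
  have hx : ∀ x : ℤ, p (x % n) x := fun x => by
    have := hp.rel_add_mul (x % n) (x / n)
    rwa [Int.emod_add_mul_ediv] at this
  rw [Setoid.comap_rel, Setoid.comap_rel, finToInt_intToFin, finToInt_intToFin]
  exact ⟨fun h => p.trans' (p.symm' (hx x)) (p.trans' h (hx y)),
    fun h => p.trans' (hx x) (p.trans' h (p.symm' (hx y)))⟩

lemma finNonCrossing_iff {s : Setoid (Fin n)} :
    FinNonCrossing s ↔ CyclicNonCrossing n (s.comap (intToFin n)) :=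
  ⟨FinNonCrossing.cyclicNonCrossing, fun h => comap_intToFin_comap_finToInt s ▸ h.finNonCrossing⟩

lemma card_shiftInvariant_finNonCrossing {d : ℕ} (hd : 0 < d) (hdn : d ∣ n) (hn : 2 * d ≤ n) :
    Nat.card {s : Setoid (Fin n) // FinNonCrossing s ∧ ShiftInvariant d (s.comap (intToFin n))} =
      (2 * d).choose d := by
  rw [← card_shiftInvariant_cyclicNonCrossing hd hdn hn]
  exact Nat.card_congr
    { toFun := fun s => ⟨s.1.comap (intToFin n), s.2.1.cyclicNonCrossing, s.2.2⟩
      invFun := fun p => ⟨p.1.comap finToInt, p.2.1.finNonCrossing, by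
        rw [p.2.1.comap_finToInt_comap_intToFin]
        exact p.2.2⟩
      left_inv := fun s => Subtype.ext (comap_intToFin_comap_finToInt s.1)
      right_inv := fun p => Subtype.ext p.2.1.comap_finToInt_comap_intToFin }

end Fin

section Partition

variable {L : ℕ}

lemma Finpartition.mem_parts_iff {α : Type*} [Fintype α] [DecidableEq α]
    (P : Finpartition (univ : Finset α)) {t : Finset α} : t ∈ P.parts ↔ ∃ a, P.part a = t := by
  refine ⟨fun h => ?_, ?_⟩
  · obtain ⟨a, -, ha⟩ := P.part_surjOn h
    exact ⟨a, ha⟩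
  · rintro ⟨a, rfl⟩
    exact P.part_mem.2 (mem_univ a)

lemma Finpartition.ext_part {α : Type*} [Fintype α] [DecidableEq α]
    {P Q : Finpartition (univ : Finset α)} (h : ∀ a, P.part a = Q.part a) : P = Q :=
  Finpartition.ext (Finset.ext fun t => by simp [Finpartition.mem_parts_iff, h])

/-- The correspondence between partitions and equivalence relations. -/
noncomputable def Finpartition.equivSetoid {α : Type*} [Fintype α] [DecidableEq α] :
    Finpartition (univ : Finset α) ≃ Setoid α where
  toFun P := Setoid.ker P.part
  invFun s := by
    classical exact Finpartition.ofSetoid s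
  left_inv P := by
    classical
    refine Finpartition.ext_part fun a => Finset.ext fun b => ?_
    rw [Finpartition.mem_part_ofSetoid_iff_rel, P.mem_part_iff_part_eq_part (mem_univ b)
      (mem_univ a), Setoid.ker_def, eq_comm]
  right_inv s := by
    classical
    ext a b
    change Finpartition.part _ a = Finpartition.part _ b ↔ _
    rw [← Finpartition.mem_part_iff_part_eq_part _ (mem_univ a) (mem_univ b),
      Finpartition.mem_part_ofSetoid_iff_rel]
    exact ⟨s.symm', s.symm'⟩

lemma Finpartition.equivSetoid_iff_mem_part {α : Type*} [Fintype α] [DecidableEq α]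
    {P : Finpartition (univ : Finset α)} {a b : α} : equivSetoid P a b ↔ a ∈ P.part b :=
  (P.mem_part_iff_part_eq_part (mem_univ a) (mem_univ b)).symm

lemma Finpartition.equivSetoid_iff {α : Type*} [Fintype α] [DecidableEq α]
    {P : Finpartition (univ : Finset α)} {a b : α} :
    equivSetoid P a b ↔ ∃ B ∈ P.parts, a ∈ B ∧ b ∈ B := by
  rw [equivSetoid_iff_mem_part, P.mem_part_iff_exists]

lemma nonCrossing_iff {P : Finpartition (univ : Finset (Fin L))} :
    NonCrossing P ↔ FinNonCrossing (Finpartition.equivSetoid P) := by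
  constructor
  · intro h a b c d hab hbc hcd hac hbd
    obtain ⟨B, hB, ha, hc⟩ := Finpartition.equivSetoid_iff.1 hac
    obtain ⟨B', hB', hb, hd⟩ := Finpartition.equivSetoid_iff.1 hbd
    by_contra hne
    refine h ⟨a, b, c, d, hab, hbc, hcd, B, hB, B', hB', ?_, ha, hc, hb, hd⟩
    rintro rfl
    exact hne (Finpartition.equivSetoid_iff.2 ⟨B, hB, ha, hb⟩)
  · rintro h ⟨a, b, c, d, hab, hbc, hcd, B, hB, B', hB', hne, ha, hc, hb, hd⟩
    obtain ⟨B₀, hB₀, ha', hb'⟩ := Finpartition.equivSetoid_iff.1 (h a b c d hab hbc hcd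
      (Finpartition.equivSetoid_iff.2 ⟨B, hB, ha, hc⟩)
      (Finpartition.equivSetoid_iff.2 ⟨B', hB', hb, hd⟩))
    exact hne ((P.eq_of_mem_parts hB hB₀ ha ha').trans (P.eq_of_mem_parts hB₀ hB' hb' hb))

lemma parts_eq_permParts_iff {σ : Equiv.Perm (Fin L)}
    {P Q : Finpartition (univ : Finset (Fin L))} : Q.parts = permParts σ P ↔
      Finpartition.equivSetoid Q = (Finpartition.equivSetoid P).comap ⇑σ⁻¹ := by
  have hmem : ∀ (B : Finset (Fin L)) a, a ∈ B.image σ ↔ σ⁻¹ a ∈ B := fun B a => by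
    simp only [mem_image]
    exact ⟨by rintro ⟨b, hb, rfl⟩; simpa using hb, fun h => ⟨_, h, by simp⟩⟩
  constructor
  · intro h
    ext a b
    rw [Finpartition.equivSetoid_iff, Setoid.comap_rel, Finpartition.equivSetoid_iff, h]
    simp [permParts, hmem]
  · intro h
    have key : ∀ a, Q.part (σ a) = (P.part a).image σ := fun a => Finset.ext fun b => by
      rw [hmem, ← Finpartition.equivSetoid_iff_mem_part, ← Finpartition.equivSetoid_iff_mem_part, h,
        Setoid.comap_rel, Equiv.Perm.inv_def, Equiv.symm_apply_apply]
    ext t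
    rw [Finpartition.mem_parts_iff, σ.surjective.exists]
    simp only [key, permParts, mem_image, Finpartition.mem_parts_iff, exists_exists_eq_and]

lemma orbitSet_eq_iff {H : Subgroup (Equiv.Perm (Fin L))}
    {P Q : Finpartition (univ : Finset (Fin L))} :
    orbitSet H P = orbitSet H Q ↔ ∃ σ ∈ H,
      Finpartition.equivSetoid P = (Finpartition.equivSetoid Q).comap ⇑σ⁻¹ := by
  constructor
  · intro h
    have : P ∈ orbitSet H P := ⟨1, H.one_mem, by simp [permParts]⟩
    rw [h] at this
    obtain ⟨σ, hσ, h⟩ := this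
    exact ⟨σ, hσ, parts_eq_permParts_iff.1 h⟩
  · rintro ⟨σ, hσ, h⟩
    ext R
    simp only [orbitSet, Set.mem_ofPred_eq, parts_eq_permParts_iff, h]
    constructor
    · rintro ⟨τ, hτ, hR⟩
      refine ⟨τ * σ, H.mul_mem hτ hσ, hR.trans (Setoid.ext fun a b => ?_)⟩
      simp [Setoid.comap_rel]
    · rintro ⟨τ, hτ, hR⟩
      refine ⟨τ * σ⁻¹, H.mul_mem hτ (H.inv_mem hσ), hR.trans (Setoid.ext fun a b => ?_)⟩
      simp [Setoid.comap_rel]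

end Partition

lemma sum_range_gcd (N : ℕ) (f : ℕ → ℕ) :
    ∑ k ∈ range N, f (N.gcd k) = ∑ e ∈ N.divisors, Nat.totient (N / e) * f e := by
  rcases N.eq_zero_or_pos with rfl | hN
  · simp
  rw [← sum_fiberwise_of_maps_to (g := N.gcd) (t := N.divisors)
    fun k _ => Nat.mem_divisors.2 ⟨Nat.gcd_dvd_left N k, hN.ne'⟩]
  refine sum_congr rfl fun e he => ?_
  rw [Nat.totient_div_of_dvd (Nat.dvd_of_mem_divisors he), card_eq_sum_ones, sum_mul]
  refine sum_congr rfl fun k hk => ?_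
  rw [(mem_filter.1 hk).2, one_mul]

section Rotation

variable {n : ℕ} [NeZero n] {ρ : Equiv.Perm (Fin n)}

lemma rotation_intToFin {t : ℕ} (hρ : ∀ i : Fin n, (ρ i : ℕ) = (i + t) % n) (x : ℤ) :
    ρ (intToFin n x) = intToFin n (x + t) := by
  rw [← intToFin_finToInt (ρ (intToFin n x)), intToFin_eq_iff]
  have h : finToInt (ρ (intToFin n x)) = (finToInt (intToFin n x) + t) % n := by
    unfold finToInt
    rw [hρ]
    push_cast
    rfl
  rw [h, finToInt_intToFin, Int.emod_emod, Int.emod_add_emod]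

lemma rotation_zpow_intToFin {t : ℕ} (hρ : ∀ i : Fin n, (ρ i : ℕ) = (i + t) % n) (k x : ℤ) :
    (ρ ^ k) (intToFin n x) = intToFin n (x + t * k) := by
  induction k using Int.induction_on generalizing x with
  | zero => simp
  | succ i ih =>
    rw [zpow_add_one, Equiv.Perm.mul_apply, rotation_intToFin hρ, ih]
    congr 1
    ring
  | pred i ih =>
    have h : ρ⁻¹ (intToFin n x) = intToFin n (x - t) := by
      rw [Equiv.Perm.inv_eq_iff_eq, rotation_intToFin hρ, sub_add_cancel]
    rw [zpow_sub_one, Equiv.Perm.mul_apply, h, ih]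
    congr 1
    ring

lemma comap_rotation_zpow_rel {t : ℕ} (hρ : ∀ i : Fin n, (ρ i : ℕ) = (i + t) % n) (k : ℤ)
    (s : Setoid (Fin n)) (x y : ℤ) : (s.comap ⇑(ρ ^ k)).comap (intToFin n) x y ↔
      s.comap (intToFin n) (x + t * k) (y + t * k) := by
  simp only [Setoid.comap_rel, rotation_zpow_intToFin hρ]

lemma FinNonCrossing.comap_rotation_zpow {t : ℕ} (hρ : ∀ i : Fin n, (ρ i : ℕ) = (i + t) % n)
    {s : Setoid (Fin n)} (hs : FinNonCrossing s) (k : ℤ) : FinNonCrossing (s.comap ⇑(ρ ^ k)) := by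
  rw [finNonCrossing_iff] at hs ⊢
  constructor
  · intro x
    rw [comap_rotation_zpow_rel hρ, add_right_comm]
    exact hs.rel_add _
  · intro x y z w hxy hyz hzw hwx
    simp only [comap_rotation_zpow_rel hρ]
    exact hs.nonCrossing _ _ _ _ (by lia) (by lia) (by lia) (by lia)

lemma comap_rotation_zpow_eq_iff {t : ℕ} (hρ : ∀ i : Fin n, (ρ i : ℕ) = (i + t) % n) (k : ℤ)
    (s : Setoid (Fin n)) :
    s.comap ⇑(ρ ^ k) = s ↔ ShiftInvariant (t * k) (s.comap (intToFin n)) := by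
  constructor
  · intro h x y
    rw [← comap_rotation_zpow_rel hρ, h]
  · intro h
    rw [← comap_intToFin_comap_finToInt (s.comap ⇑(ρ ^ k)), ← comap_intToFin_comap_finToInt s]
    congr 1
    ext x y
    rw [comap_intToFin_comap_finToInt, comap_rotation_zpow_rel hρ, h]

lemma card_fixed_rotation_pow {N : ℕ} (hn : n = 2 * N)
    (hρ : ∀ i : Fin n, (ρ i : ℕ) = (i + 2) % n) (k : ℕ) :
    Nat.card {s : Setoid (Fin n) // FinNonCrossing s ∧ s.comap ⇑(ρ ^ k) = s} =
      if N.gcd k = N then catalan n else (2 * (2 * N.gcd k)).choose (2 * N.gcd k) := by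
  have hn0 := NeZero.pos n
  have hiff : ∀ s : Setoid (Fin n), FinNonCrossing s ∧ s.comap ⇑(ρ ^ k) = s ↔
      FinNonCrossing s ∧ ShiftInvariant (2 * N.gcd k : ℕ) (s.comap (intToFin n)) := by
    refine fun s => and_congr_right fun hs => ?_
    have h := comap_rotation_zpow_eq_iff (t := 2) hρ k s
    rw [zpow_natCast, ← Nat.cast_mul, hs.cyclicNonCrossing.shiftInvariant_iff_gcd] at h
    rw [h, show n.gcd (2 * k) = 2 * N.gcd k by rw [hn, Nat.gcd_mul_left]]
  rw [Nat.card_congr (Equiv.subtypeEquivRight hiff)]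
  split_ifs with h
  · rw [← card_finNonCrossing]
    refine Nat.card_congr (Equiv.subtypeEquivRight fun s => and_iff_left_of_imp fun hs => ?_)
    rw [h, ← hn]
    exact hs.cyclicNonCrossing.shiftInvariant
  · have hdvd : N.gcd k ∣ N := Nat.gcd_dvd_left N k
    have hpos : 0 < N.gcd k := Nat.gcd_pos_of_pos_left k (by lia)
    refine card_shiftInvariant_finNonCrossing (by lia) (hn ▸ Nat.mul_dvd_mul_left 2 hdvd) ?_
    obtain ⟨q, hq⟩ := hdvd
    have hq0 : q ≠ 0 := by rintro rfl; lia
    have hq1 : q ≠ 1 := by rintro rfl; lia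
    have : N.gcd k * 2 ≤ N.gcd k * q := by gcongr; lia
    lia

lemma orderOf_rotation {N : ℕ} (hn : n = 2 * N)
    (hρ : ∀ i : Fin n, (ρ i : ℕ) = (i + 2) % n) : orderOf ρ = N := by
  have hn0 := NeZero.pos n
  have hpow : ∀ k : ℕ, ρ ^ k = 1 ↔ N ∣ k := by
    intro k
    have h1 : ρ ^ k = 1 ↔ ∀ x : ℤ, intToFin n (x + 2 * k) = intToFin n x := by
      rw [← zpow_natCast, Equiv.ext_iff]
      constructor
      · intro h x
        have := rotation_zpow_intToFin (t := 2) hρ k x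
        rw [h] at this
        exact this.symm
      · intro h i
        rw [← intToFin_finToInt i, rotation_zpow_intToFin (t := 2) hρ]
        exact h _
    have h2 : (n : ℤ) ∣ 2 * k ↔ N ∣ k := by
      rw [hn, Nat.cast_mul, Nat.cast_ofNat, mul_dvd_mul_iff_left two_ne_zero,
        Int.natCast_dvd_natCast]
    rw [h1, ← h2]
    simp only [intToFin_eq_iff, Int.emod_eq_emod_iff_emod_sub_eq_zero, add_sub_cancel_left,
      forall_const, Int.dvd_iff_emod_eq_zero]
  exact Nat.dvd_antisymm (orderOf_dvd_of_pow_eq_one ((hpow N).2 dvd_rfl))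
    ((hpow _).1 (pow_orderOf_eq_one ρ))

/-- The action of rotations on non-crossing equivalence relations. -/
@[reducible]
def rotationAction {t : ℕ} (hρ : ∀ i : Fin n, (ρ i : ℕ) = (i + t) % n) :
    MulAction (Subgroup.zpowers ρ) {s : Setoid (Fin n) // FinNonCrossing s} where
  smul σ s := ⟨s.1.comap ⇑(σ⁻¹ : Equiv.Perm (Fin n)), by
    obtain ⟨k, hk⟩ := Subgroup.mem_zpowers_iff.1 (inv_mem σ.2)
    rw [← hk]
    exact s.2.comap_rotation_zpow hρ k⟩
  one_smul s := Subtype.ext rfl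
  mul_smul σ τ s := Subtype.ext (Setoid.ext fun a b => by
    change s.1 _ _ ↔ s.1 _ _
    simp)

lemma ncard_image_orbitSet (hρ : ∀ i : Fin n, (ρ i : ℕ) = (i + 2) % n) :
    (orbitSet (Subgroup.closure {ρ}) '' {P | NonCrossing P}).ncard * orderOf ρ =
      ∑ k ∈ range (orderOf ρ),
        Nat.card {s : Setoid (Fin n) // FinNonCrossing s ∧ s.comap ⇑(ρ ^ k) = s} := by
  classical
  let _ := rotationAction hρ
  have hsmul : ∀ (σ : Subgroup.zpowers ρ) (s : {s : Setoid (Fin n) // FinNonCrossing s}),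
      (σ • s).1 = s.1.comap ⇑(σ : Equiv.Perm (Fin n))⁻¹ := fun _ _ => rfl
  have : Finite (Setoid (Fin n)) := Finite.of_equiv _ Finpartition.equivSetoid
  let _ : Fintype {s : Setoid (Fin n) // FinNonCrossing s} := Fintype.ofFinite _
  have burnside := MulAction.sum_card_fixedBy_eq_card_orbits_mul_card_group (Subgroup.zpowers ρ)
    {s : Setoid (Fin n) // FinNonCrossing s}
  rw [← Nat.card_eq_fintype_card, ← Nat.card_eq_fintype_card, Nat.card_zpowers] at burnside
  let f : {s : Setoid (Fin n) // FinNonCrossing s} → Set (Finpartition (univ : Finset (Fin n))) :=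
    fun s => orbitSet (Subgroup.closure {ρ}) (Finpartition.equivSetoid.symm s.1)
  have hf : orbitSet (Subgroup.closure {ρ}) '' {P | NonCrossing P} = Set.range f := by
    ext O
    constructor
    · rintro ⟨P, hP, rfl⟩
      exact ⟨⟨Finpartition.equivSetoid P, nonCrossing_iff.1 hP⟩, by simp [f]⟩
    · rintro ⟨s, rfl⟩
      exact ⟨Finpartition.equivSetoid.symm s.1, nonCrossing_iff.2 (by simpa using s.2), rfl⟩
  have hker : Setoid.ker f = MulAction.orbitRel (Subgroup.zpowers ρ) _ := by
    ext s r
    rw [Setoid.ker_def, MulAction.orbitRel_apply, orbitSet_eq_iff, Equiv.apply_symm_apply,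
      Equiv.apply_symm_apply, ← Subgroup.zpowers_eq_closure]
    constructor
    · rintro ⟨σ, hσ, h⟩
      exact ⟨⟨σ, hσ⟩, Subtype.ext ((hsmul _ _).trans h.symm)⟩
    · rintro ⟨⟨σ, hσ⟩, h⟩
      exact ⟨σ, hσ, (congrArg Subtype.val h).symm.trans (hsmul _ _)⟩
  rw [hf, ← Nat.card_coe_set_eq, ← Nat.card_congr (Setoid.quotientKerEquivRange f), hker,
    ← burnside, ← (finEquivZPowers (isOfFinOrder_of_finite ρ)).sum_comp, ← Fin.sum_univ_eq_sum_range
      (fun k => Nat.card {s : Setoid (Fin n) // FinNonCrossing s ∧ s.comap ⇑(ρ ^ k) = s})]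
  refine Fintype.sum_congr _ _ fun k => ?_
  rw [← Nat.card_eq_fintype_card, finEquivZPowers_apply]
  refine Nat.card_congr ((Equiv.subtypeEquivRight fun s => ?_).trans
    (Equiv.subtypeSubtypeEquivSubtypeInter _ fun s : Setoid (Fin n) => s.comap ⇑(ρ ^ (k : ℕ)) = s))
  rw [MulAction.mem_fixedBy, ← eq_inv_smul_iff, eq_comm, Subtype.ext_iff, hsmul]
  simp

lemma ncard_image_orbitSet_mul {N : ℕ} (hn : n = 2 * N)
    (hρ : ∀ i : Fin n, (ρ i : ℕ) = (i + 2) % n) :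
    (orbitSet (Subgroup.closure {ρ}) '' {P | NonCrossing P}).ncard * N =
      ∑ e ∈ N.divisors, Nat.totient (N / e) *
        if e = N then catalan n else (2 * (2 * e)).choose (2 * e) := by
  have h := ncard_image_orbitSet hρ
  rw [orderOf_rotation hn hρ] at h
  rw [h, ← sum_range_gcd N fun e => if e = N then catalan n else (2 * (2 * e)).choose (2 * e)]
  exact sum_congr rfl fun k _ => card_fixed_rotation_pow hn hρ k

end Rotation

lemma sum_filter_even_divisors {M : Type*} [AddCommMonoid M] (N : ℕ) (f : ℕ → M) :
    ∑ d ∈ (2 * N).divisors with Even d ∧ d < 2 * N, f d = ∑ e ∈ N.properDivisors, f (2 * e) := by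
  symm
  refine sum_bij (fun e _ => 2 * e) ?_ ?_ ?_ fun _ _ => rfl
  · intro e he
    rw [Nat.mem_properDivisors] at he
    rw [mem_filter, Nat.mem_divisors]
    exact ⟨⟨Nat.mul_dvd_mul_left 2 he.1, by lia⟩, even_two_mul e, by lia⟩
  · intro a _ b _ h
    lia
  · intro d hd
    rw [mem_filter, Nat.mem_divisors] at hd
    obtain ⟨⟨h1, -⟩, h2, h3⟩ := hd
    obtain ⟨e, rfl⟩ := h2.two_dvd
    exact ⟨e, Nat.mem_properDivisors.2 ⟨Nat.dvd_of_mul_dvd_mul_left two_pos h1, by lia⟩, rfl⟩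

/-- Lemma 2.1 of the paper: for even `L > 0`, letting `N'_L` be the number of orbits of
non-crossing partitions of `{1,…,L}` under the cyclic group generated by the rotation
`ρ₂(i) = i+2 (mod L)`, and `C_L = (1/(L+1))·binom(2L,L)` the number of non-crossing
partitions, one has
`(L/2)·N'_L − C_L = Σ_{d even, d|L, 1 ≤ d < L} φ(L/d)·binom(2d, d)`. -/
theorem noncrossing_rotation_orbits_excess (L : ℕ) (hL : 0 < L) (hE : Even L)
    (ρ₂ : Equiv.Perm (Fin L))
    (hρ : ∀ i : Fin L, ((ρ₂ i : ℕ)) = ((i : ℕ) + 2) % L) :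
    ((L : ℚ) / 2) * (((orbitSet (Subgroup.closure {ρ₂})) '' {P | NonCrossing P}).ncard : ℚ)
        - (1 / (L + 1)) * Nat.choose (2 * L) L
      = ∑ d ∈ L.divisors.filter (fun d => Even d ∧ d < L),
          (Nat.totient (L / d) : ℚ) * Nat.choose (2 * d) d := by
  obtain ⟨N, rfl⟩ := hE.two_dvd
  have hN : 0 < N := by lia
  have : NeZero (2 * N) := ⟨hL.ne'⟩
  have hcat : (1 / (((2 * N : ℕ) : ℚ) + 1)) * Nat.choose (2 * (2 * N)) (2 * N) =
      catalan (2 * N) := by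
    have h := succ_mul_catalan_eq_centralBinom (2 * N)
    rw [Nat.centralBinom] at h
    rw [one_div_mul_eq_div, div_eq_iff (by positivity), mul_comm (catalan _ : ℚ)]
    exact_mod_cast h.symm
  have key := ncard_image_orbitSet_mul rfl hρ
  rw [← Nat.cons_self_properDivisors hN.ne', sum_cons, if_pos rfl, Nat.div_self hN,
    Nat.totient_one, one_mul, ← Nat.cast_inj (R := ℚ)] at key
  rw [sum_filter_even_divisors, hcat, sub_eq_iff_eq_add']
  convert key using 1
  · push_cast
    ring
  · push_cast
    congr 1
    refine sum_congr rfl fun e he => ?_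
    rw [if_neg (Nat.mem_properDivisors.1 he).2.ne, Nat.mul_div_mul_left _ _ two_pos]
end

section
/- Let L be an even positive integer. Let N'_L denote the number of orbits of the set of non-crossing partitions of {1,…,L} under the cyclic group generated by the rotation ρ₂ (ρ₂(i) = i+2 reduced modulo L to lie in {1,…,L}), and let N_L denote the number of orbits under the group generated by ρ₂ and the reflection τ (τ(i) = L+1−i), both acting on partitions by σ·P = {σ(B) : B ∈ P}. Then 2·N_L − N'_L = binom(L, L/2). (Lemma 2.2 of the paper: 2·N_{Z,hc,PF,L_y} − N'_{Z,hc,PF,L_y} = N_{Z,FP,L_y/2} = binom(L_y, L_y/2).) -/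
open Finset

open scoped Pointwise in
/-- The number of orbits meeting an invariant set, through Burnside's lemma. -/
theorem sum_ncard_fixed_eq_ncard_orbits_mul_card {G Y : Type*} [Group G] [Fintype G] [Finite Y]
    [MulAction G Y] (H : Subgroup G) [DecidablePred (· ∈ H)] (X : Set Y)
    (hX : H ≤ MulAction.stabilizer G X) :
    ∑ g ∈ univ.filter (· ∈ H), {x | x ∈ X ∧ g • x = x}.ncard =
      ((fun x : Y => {y | ∃ g ∈ H, y = g • x}) '' X).ncard * Nat.card H := by
  classical
  have hmem : ∀ g ∈ H, ∀ x ∈ X, g • x ∈ X := fun g hg =>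
    (MulAction.mem_stabilizer_set' X.toFinite).1 (hX hg)
  let S : SubMulAction H Y := ⟨X, fun g {x} hx => hmem g g.2 x hx⟩
  have : Fintype S := Fintype.ofFinite _
  have : Fintype (Quotient (MulAction.orbitRel H S)) := Fintype.ofFinite _
  have key := MulAction.sum_card_fixedBy_eq_card_orbits_mul_card_group H S
  rw [Nat.card_eq_fintype_card]
  convert key using 2
  · rw [← Finset.sum_subtype_eq_sum_filter, Finset.subtype_univ]
    refine Finset.sum_congr rfl fun g _ => ?_
    rw [← Nat.card_eq_fintype_card, ← Nat.card_coe_set_eq]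
    refine Nat.card_congr
      ⟨fun x => ⟨⟨x.1, x.2.1⟩, Subtype.ext x.2.2⟩,
        fun x => ⟨x.1.1, x.1.2, congrArg Subtype.val x.2⟩, fun _ => rfl, fun _ => rfl⟩
  · rw [← Nat.card_eq_fintype_card, ← Nat.card_coe_set_eq]
    symm
    have hrel : ∀ a b : S, MulAction.orbitRel H S a b ↔
        {y | ∃ g ∈ H, y = g • (a : Y)} = {y | ∃ g ∈ H, y = g • (b : Y)} := by
      intro a b
      rw [MulAction.orbitRel_apply, MulAction.mem_orbit_iff]
      constructor
      · rintro ⟨g, rfl⟩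
        ext y
        constructor
        · rintro ⟨k, hk, rfl⟩
          exact ⟨k * g, H.mul_mem hk g.2, by rw [mul_smul]; rfl⟩
        · rintro ⟨k, hk, rfl⟩
          exact ⟨k * (g : G)⁻¹, H.mul_mem hk (H.inv_mem g.2), by
            rw [mul_smul, show ((g • b : S) : Y) = (g : G) • (b : Y) from rfl, inv_smul_smul]⟩
      · intro h
        have : (a : Y) ∈ {y | ∃ g ∈ H, y = g • (b : Y)} := h ▸ ⟨1, H.one_mem, (one_smul _ _).symm⟩
        obtain ⟨g, hg, e⟩ := this
        exact ⟨⟨g, hg⟩, Subtype.ext e.symm⟩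
    refine Nat.card_congr (Equiv.ofBijective (Quotient.lift
      (fun x : S => (⟨{y | ∃ g ∈ H, y = g • (x : Y)}, x, x.2, rfl⟩ :
        ((fun x : Y => {y | ∃ g ∈ H, y = g • x}) '' X : Set (Set Y))))
      fun a b h => Subtype.ext ((hrel a b).1 h)) ⟨?_, ?_⟩)
    · rintro ⟨a⟩ ⟨b⟩ h
      exact Quotient.sound ((hrel a b).2 (congrArg Subtype.val h))
    · rintro ⟨_, x, hx, rfl⟩
      exact ⟨Quotient.mk _ ⟨x, hx⟩, rfl⟩

open scoped Pointwise in
theorem ncard_fixed_conj {G Y : Type*} [Group G] [MulAction G Y] (X : Set Y) (g t : G)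
    (hg : g ∈ MulAction.stabilizer G X) :
    {x | x ∈ X ∧ (g * t * g⁻¹) • x = x}.ncard = {x | x ∈ X ∧ t • x = x}.ncard := by
  rw [← Set.ncard_image_of_injective {x | x ∈ X ∧ t • x = x} (MulAction.injective g)]
  congr 1
  ext x
  have hx : g⁻¹ • x ∈ X ↔ x ∈ X := by
    conv_rhs => rw [← MulAction.mem_stabilizer_iff.1 hg, Set.mem_smul_set_iff_inv_smul_mem]
  constructor
  · rintro ⟨h1, h2⟩
    refine ⟨g⁻¹ • x, ⟨hx.2 h1, ?_⟩, smul_inv_smul _ _⟩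
    rw [eq_inv_smul_iff, smul_smul, smul_smul, h2]
  · rintro ⟨y, ⟨h1, h2⟩, rfl⟩
    refine ⟨?_, ?_⟩
    · rw [← hx]
      simpa using h1
    · simp [mul_smul, h2]

open scoped Pointwise in
/-- If `g` is inverted by an involution `t` and `t` is not a power of `g ^ 2`, then the elements
`g ^ (2 * k) * t` are conjugate to `t`, so that Burnside's lemma for the groups generated by
`g ^ 2` and by `g ^ 2, t` compares their numbers of orbits. -/
theorem two_mul_ncard_orbits_sub {G Y : Type*} [Group G] [Finite G] [Finite Y]
    [MulAction G Y] (X : Set Y) (g t : G) (ht : t * t = 1) (hgt : t * g * t = g⁻¹)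
    (hnot : t ∉ Subgroup.closure {g * g})
    (hgX : ∀ x ∈ X, g • x ∈ X) (htX : ∀ x ∈ X, t • x ∈ X) :
    2 * ((((fun x : Y => {y | ∃ h ∈ Subgroup.closure {g * g, t}, y = h • x}) '' X).ncard : ℤ))
      - (((fun x : Y => {y | ∃ h ∈ Subgroup.closure {g * g}, y = h • x}) '' X).ncard : ℤ)
      = ({x | x ∈ X ∧ t • x = x}.ncard : ℤ) := by
  classical
  have : Fintype G := Fintype.ofFinite _
  have hgS := (MulAction.mem_stabilizer_set' (a := g) X.toFinite).2 hgX
  have htS := (MulAction.mem_stabilizer_set' (a := t) X.toFinite).2 htX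
  set C := Subgroup.closure {g * g} with hC
  set D := Subgroup.closure {g * g, t} with hD
  have hCD : C ≤ D := Subgroup.closure_mono (by simp)
  have htD : t ∈ D := Subgroup.subset_closure (by simp)
  have htinv : t⁻¹ = t := inv_eq_of_mul_eq_one_left ht
  have hconj : ∀ c ∈ C, t * c * t ∈ C := by
    intro c hc
    have : c ∈ C.comap (MulAut.conj t).toMonoidHom := by
      refine (Subgroup.closure_le _).2 ?_ hc
      rintro _ rfl
      have h1 : t * (g * g) * t = (g * g)⁻¹ := by
        calc t * (g * g) * t = (t * g * t) * (t * g * t) := by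
              simp only [mul_assoc]; rw [← mul_assoc t t, ht, one_mul]
          _ = _ := by rw [hgt, mul_inv_rev]
      simp only [Subgroup.coe_comap, Set.mem_preimage, SetLike.mem_coe]
      simp only [MulEquiv.coe_toMonoidHom, MulAut.conj_apply, htinv]
      rw [h1]
      exact C.inv_mem (Subgroup.subset_closure rfl)
    simpa [htinv] using this
  have hDmem : ∀ d, d ∈ D ↔ d ∈ C ∨ d * t ∈ C := by
    intro d
    constructor
    · intro hd
      induction hd using Subgroup.closure_induction with
      | mem x hx =>
        rcases hx with rfl | rfl
        · exact Or.inl (Subgroup.subset_closure rfl)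
        · exact Or.inr (by rw [ht]; exact C.one_mem)
      | one => exact Or.inl C.one_mem
      | mul x y _ _ hx hy =>
        rcases hx with hx | hx <;> rcases hy with hy | hy
        · exact Or.inl (C.mul_mem hx hy)
        · exact Or.inr (by rw [mul_assoc]; exact C.mul_mem hx hy)
        · refine Or.inr ?_
          have := C.mul_mem hx (hconj y hy)
          rwa [show x * t * (t * y * t) = x * (t * t) * y * t by group, ht, mul_one] at this
        · refine Or.inl ?_
          have := C.mul_mem hx (hconj _ hy)
          rwa [show x * t * (t * (y * t) * t) = x * (t * t) * y * (t * t) by group, ht, mul_one,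
            mul_one] at this
      | inv x _ hx =>
        rcases hx with hx | hx
        · exact Or.inl (C.inv_mem hx)
        · refine Or.inr ?_
          have := hconj _ (C.inv_mem hx)
          rwa [mul_inv_rev, htinv, ← mul_assoc, ht, one_mul] at this
    · rintro (h | h)
      · exact hCD h
      · have := D.mul_mem (hCD h) htD
        rwa [mul_assoc, ht, mul_one] at this
  have hDS : D ≤ MulAction.stabilizer G X := by
    rw [hD, Subgroup.closure_le]
    rintro _ (rfl | rfl)
    · exact mul_mem hgS hgS
    · exact htS
  have hsplit : univ.filter (· ∈ D) =
      univ.filter (· ∈ C) ∪ (univ.filter (· ∈ C)).image (· * t) := by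
    ext d
    simp only [mem_filter, mem_univ, true_and, mem_union, mem_image, hDmem]
    refine or_congr Iff.rfl ⟨fun h => ⟨_, h, by rw [mul_assoc, ht, mul_one]⟩, ?_⟩
    rintro ⟨c, hc, rfl⟩
    rwa [mul_assoc, ht, mul_one]
  have hdisj : Disjoint (univ.filter (· ∈ C)) ((univ.filter (· ∈ C)).image (· * t)) := by
    rw [Finset.disjoint_left]
    simp only [mem_filter, mem_univ, true_and, mem_image, not_exists, not_and]
    rintro _ hd c hc rfl
    exact hnot (by simpa using C.mul_mem (C.inv_mem hc) hd)
  have hfix : ∀ c ∈ univ.filter (· ∈ C), {x | x ∈ X ∧ (c * t) • x = x}.ncard =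
      {x | x ∈ X ∧ t • x = x}.ncard := by
    intro c hc
    simp only [mem_filter, mem_univ, true_and, hC, Subgroup.mem_closure_singleton] at hc
    obtain ⟨k, rfl⟩ := hc
    rw [← ncard_fixed_conj X (g ^ k) t (Subgroup.zpow_mem _ hgS k)]
    have h2 : t * g ^ k * t = (g ^ k)⁻¹ := by
      have := conj_zpow (i := k) (a := t) (b := g)
      rw [htinv, hgt] at this
      rw [← this, inv_zpow]
    have h3 : (g * g) ^ k * t = g ^ k * t * (g ^ k)⁻¹ := by
      rw [← h2, (Commute.refl g).mul_zpow,
        show g ^ k * t * (t * g ^ k * t) = g ^ k * (t * t) * g ^ k * t by group, ht, mul_one]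
    rw [h3]
  have hcardC : (univ.filter (· ∈ C)).card = Nat.card C := by
    rw [Nat.card_eq_fintype_card, Fintype.card_subtype]
  have hcardD : Nat.card D = 2 * Nat.card C := by
    have : (univ.filter (· ∈ D)).card = Nat.card D := by
      rw [Nat.card_eq_fintype_card, Fintype.card_subtype]
    rw [← this, hsplit, card_union_of_disjoint hdisj,
      card_image_of_injective _ (mul_left_injective t), hcardC, two_mul]
  have e1 := sum_ncard_fixed_eq_ncard_orbits_mul_card C X (hCD.trans hDS)
  have e2 := sum_ncard_fixed_eq_ncard_orbits_mul_card D X hDS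
  rw [hsplit, sum_union hdisj, sum_image (fun _ _ _ _ h => mul_left_injective t h), e1,
    sum_congr rfl hfix, sum_const, hcardC, hcardD, smul_eq_mul] at e2
  have hpos : (0 : ℤ) < Nat.card C := by exact_mod_cast Nat.card_pos
  have e3 := congrArg (Nat.cast : ℕ → ℤ) e2
  push_cast at e3
  refine mul_left_cancel₀ hpos.ne' ?_
  linarith

/-- The number of open blocks before position `i`, starting from `a` open blocks, when the letter
`(s, e)` at a position says whether a block starts there and whether a block ends there. -/
def openCount (u : ℕ → Bool × Bool) (a : ℕ) : ℕ → ℕ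
  | 0 => a
  | i + 1 => openCount u a i + (u i).1.toNat - (u i).2.toNat

/-- Words of length `m` (continued by `(false, false)`) in which a block is open whenever
an element not starting a new block is read. -/
def openWords (m a : ℕ) : Set (ℕ → Bool × Bool) :=
  {u | (∀ i, m ≤ i → u i = (false, false)) ∧
    ∀ i < m, (u i).1 = true ∨ 0 < openCount u a i}

/-- The word `u` with the letter `x` put in front. -/
def consWord (x : Bool × Bool) (u : ℕ → Bool × Bool) : ℕ → Bool × Bool
  | 0 => x
  | i + 1 => u i

theorem consWord_injective (x : Bool × Bool) : Function.Injective (consWord x) :=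
  fun _ _ h => funext fun i => congrFun h (i + 1)

theorem openCount_consWord (x : Bool × Bool) (u : ℕ → Bool × Bool) (a i : ℕ) :
    openCount (consWord x u) a (i + 1) = openCount u (a + x.1.toNat - x.2.toNat) i := by
  induction i with
  | zero => rfl
  | succ i ih => rw [openCount, ih]; rfl

theorem consWord_mem_openWords (x : Bool × Bool) (u : ℕ → Bool × Bool) (m a : ℕ) :
    consWord x u ∈ openWords (m + 1) a ↔
      (x.1 = true ∨ 0 < a) ∧ u ∈ openWords m (a + x.1.toNat - x.2.toNat) := by
  constructor
  · rintro ⟨h1, h2⟩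
    refine ⟨h2 0 (Nat.succ_pos _), fun i hi => h1 (i + 1) (by omega), fun i hi => ?_⟩
    have := h2 (i + 1) (by omega)
    rwa [openCount_consWord] at this
  · rintro ⟨h0, h1, h2⟩
    refine ⟨fun i hi => ?_, fun i hi => ?_⟩
    · obtain ⟨i, rfl⟩ : ∃ j, i = j + 1 := ⟨i - 1, by omega⟩
      exact h1 i (by omega)
    · cases i with
      | zero => exact h0
      | succ i =>
        rw [openCount_consWord]
        exact h2 i (by omega)

theorem consWord_zero_succ (u : ℕ → Bool × Bool) : consWord (u 0) (fun i => u (i + 1)) = u := by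
  funext i
  cases i <;> rfl

theorem disjoint_image_consWord {x y : Bool × Bool} (h : x ≠ y) (A B : Set (ℕ → Bool × Bool)) :
    Disjoint (consWord x '' A) (consWord y '' B) := by
  rw [Set.disjoint_left]
  rintro _ ⟨u, -, rfl⟩ ⟨v, -, e⟩
  exact h (congrFun e 0).symm

theorem openWords_succ_zero (m : ℕ) : openWords (m + 1) 0 =
    consWord (true, false) '' openWords m 1 ∪ consWord (true, true) '' openWords m 0 := by
  ext u
  rw [← consWord_zero_succ u, consWord_mem_openWords]
  generalize (fun i => u (i + 1)) = v
  simp only [Set.mem_union, Set.mem_image]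
  constructor
  · rintro ⟨h, hv⟩
    rcases hu : u 0 with ⟨_ | _, _ | _⟩ <;> rw [hu] at h hv <;> simp at h hv ⊢
    · exact Or.inl ⟨v, hv, rfl⟩
    · exact Or.inr ⟨v, hv, rfl⟩
  · rintro (⟨w, hw, e⟩ | ⟨w, hw, e⟩) <;>
    · have e0 := congrFun e 0
      have e1 : w = v := funext fun i => congrFun e (i + 1)
      simp only [consWord] at e0
      subst e1
      rw [← e0]
      simpa using hw

theorem openWords_succ_succ (m a : ℕ) : openWords (m + 1) (a + 1) =
    (consWord (true, false) '' openWords m (a + 2) ∪ consWord (true, true) '' openWords m (a + 1)) ∪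
    (consWord (false, false) '' openWords m (a + 1) ∪ consWord (false, true) '' openWords m a) := by
  ext u
  rw [← consWord_zero_succ u, consWord_mem_openWords]
  generalize (fun i => u (i + 1)) = v
  simp only [Set.mem_union, Set.mem_image]
  constructor
  · rintro ⟨h, hv⟩
    rcases hu : u 0 with ⟨_ | _, _ | _⟩ <;> rw [hu] at h hv <;> simp at h hv ⊢
    · exact Or.inr (Or.inl ⟨v, hv, rfl⟩)
    · exact Or.inr (Or.inr ⟨v, hv, rfl⟩)
    · exact Or.inl (Or.inl ⟨v, hv, rfl⟩)
    · exact Or.inl (Or.inr ⟨v, hv, rfl⟩)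
  · rintro ((⟨w, hw, e⟩ | ⟨w, hw, e⟩) | (⟨w, hw, e⟩ | ⟨w, hw, e⟩)) <;>
    · have e0 := congrFun e 0
      have e1 : w = v := funext fun i => congrFun e (i + 1)
      simp only [consWord] at e0
      subst e1
      rw [← e0]
      simpa using hw

theorem encard_openWords_succ_zero (m : ℕ) :
    (openWords (m + 1) 0).encard = (openWords m 1).encard + (openWords m 0).encard := by
  rw [openWords_succ_zero, Set.encard_union_eq (disjoint_image_consWord (by simp) _ _),
    (consWord_injective _).encard_image, (consWord_injective _).encard_image]

theorem encard_openWords_succ_succ (m a : ℕ) :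
    (openWords (m + 1) (a + 1)).encard = ((openWords m (a + 2)).encard +
      (openWords m (a + 1)).encard) + ((openWords m (a + 1)).encard + (openWords m a).encard) := by
  rw [openWords_succ_succ, Set.encard_union_eq, Set.encard_union_eq, Set.encard_union_eq]
  · simp only [(consWord_injective _).encard_image]
  · exact disjoint_image_consWord (by simp) _ _
  · exact disjoint_image_consWord (by simp) _ _
  · simp only [Set.disjoint_union_left, Set.disjoint_union_right]
    exact ⟨⟨disjoint_image_consWord (by simp) _ _, disjoint_image_consWord (by simp) _ _⟩,
      disjoint_image_consWord (by simp) _ _, disjoint_image_consWord (by simp) _ _⟩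

theorem choose_two_mul_succ (m k : ℕ) : (2 * (m + 1)).choose (k + 2) =
    (2 * m).choose k + 2 * (2 * m).choose (k + 1) + (2 * m).choose (k + 2) := by
  rw [show 2 * (m + 1) = 2 * m + 1 + 1 by ring, Nat.choose_succ_succ', Nat.choose_succ_succ',
    Nat.choose_succ_succ' (2 * m) (k + 1)]
  ring

theorem choose_two_mul_succ_middle (m : ℕ) : (2 * (m + 1)).choose (m + 1) =
    2 * (2 * m).choose m + 2 * (2 * m).choose (m + 1) := by
  rw [show 2 * (m + 1) = 2 * m + 1 + 1 by ring, Nat.choose_succ_succ',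
    Nat.choose_symm_half]
  have : (2 * m + 1).choose m = (2 * m).choose m + (2 * m).choose (m + 1) := by
    rw [← Nat.choose_symm_half, Nat.choose_succ_succ']
  omega

theorem encard_openWords (m a : ℕ) : (openWords m a).encard =
    (((2 * m).choose m + 2 * ∑ j ∈ range a, (2 * m).choose (m + 1 + j) : ℕ) : ℕ∞) := by
  induction m generalizing a with
  | zero =>
    have : openWords 0 a = {fun _ => (false, false)} := by
      ext u
      simp [openWords, funext_iff]
    rw [this, Set.encard_singleton]
    simp [Nat.choose_eq_zero_of_lt]
  | succ m ih =>
    cases a with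
    | zero =>
      rw [encard_openWords_succ_zero, ih, ih, ← Nat.cast_add]
      congr 1
      rw [choose_two_mul_succ_middle]
      simp
      ring
    | succ a =>
      rw [encard_openWords_succ_succ, ih, ih, ih]
      norm_cast
      induction a with
      | zero =>
        rw [choose_two_mul_succ_middle]
        simp [sum_range_succ, choose_two_mul_succ]
        ring
      | succ a iha =>
        conv_rhs => rw [sum_range_succ _ (a + 1), mul_add 2 (Finset.sum _ _), ← add_assoc, ← iha]
        rw [show m + 1 + 1 + (a + 1) = (m + a + 1) + 2 by ring, choose_two_mul_succ]
        simp only [sum_range_succ]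
        rw [show m + 1 + (a + 1) = m + a + 1 + 1 by ring,
          show m + 1 + (a + 2) = m + a + 1 + 2 by ring, show m + 1 + a = m + a + 1 by ring]
        ring

section Blocks

variable {L : ℕ} {P Q : Finpartition (Finset.univ : Finset (Fin L))}

theorem part_eq_part_iff_mem {i j : Fin L} : P.part i = P.part j ↔ i ∈ P.part j :=
  (P.mem_part_iff_part_eq_part (mem_univ i) (mem_univ j)).symm

theorem nonCrossing_iff_s5 : NonCrossing P ↔ ∀ a b c d : Fin L, a < b → b < c → c < d →
    P.part a = P.part c → P.part b = P.part d → P.part a = P.part b := by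
  constructor
  · intro h a b c d hab hbc hcd hac hbd
    by_contra hne
    exact h ⟨a, b, c, d, hab, hbc, hcd, _, P.part_mem.2 (mem_univ a), _, P.part_mem.2 (mem_univ b),
      hne, P.mem_part (mem_univ a), hac ▸ P.mem_part (mem_univ c), P.mem_part (mem_univ b),
      hbd ▸ P.mem_part (mem_univ d)⟩
  · rintro h ⟨a, b, c, d, hab, hbc, hcd, B, hB, C, hC, hne, haB, hcB, hbC, hdC⟩
    have ha := P.part_eq_of_mem hB haB
    have hc := P.part_eq_of_mem hB hcB
    have hb := P.part_eq_of_mem hC hbC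
    have hd := P.part_eq_of_mem hC hdC
    exact hne (by rw [← ha, ← hb]; exact h a b c d hab hbc hcd (ha.trans hc.symm) (hb.trans hd.symm))

theorem finpartition_ext_part (h : ∀ i j, P.part i = P.part j ↔ Q.part i = Q.part j) : P = Q := by
  have hpart : ∀ j, P.part j = Q.part j := fun j => by
    ext i
    rw [← part_eq_part_iff_mem, h, part_eq_part_iff_mem]
  have hparts : ∀ R : Finpartition (Finset.univ : Finset (Fin L)),
      R.parts = univ.image R.part := fun R => by
    ext B
    simp only [mem_image, mem_univ, true_and]
    constructor
    · intro hB
      obtain ⟨x, hx⟩ := R.nonempty_of_mem_parts hB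
      exact ⟨x, R.part_eq_of_mem hB hx⟩
    · rintro ⟨x, rfl⟩
      exact R.part_mem.2 (mem_univ x)
  refine Finpartition.ext ?_
  rw [hparts P, hparts Q, funext hpart]

/-- The image partition `σ·P`. -/
def permPartition (σ : Equiv.Perm (Fin L)) (P : Finpartition (Finset.univ : Finset (Fin L))) :
    Finpartition (Finset.univ : Finset (Fin L)) :=
  Finpartition.ofExistsUnique (permParts σ P) (fun _ _ => subset_univ _)
    (fun a _ => by
      refine ⟨(P.part (σ⁻¹ a)).image σ, ⟨mem_image_of_mem _ (P.part_mem.2 (mem_univ _)),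
        mem_image.2 ⟨σ⁻¹ a, P.mem_part (mem_univ _), by simp⟩⟩, ?_⟩
      rintro _ ⟨hB, ha⟩
      obtain ⟨B, hBP, rfl⟩ := mem_image.1 hB
      obtain ⟨x, hx, rfl⟩ := mem_image.1 ha
      simp [P.part_eq_of_mem hBP hx])
    (fun h => by
      obtain ⟨B, hB, e⟩ := mem_image.1 h
      exact P.ne_empty hB (image_eq_empty.1 e))

instance : MulAction (Equiv.Perm (Fin L)) (Finpartition (Finset.univ : Finset (Fin L))) where
  smul := permPartition
  one_smul P := Finpartition.ext (show permParts 1 P = P.parts by simp [permParts])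
  mul_smul σ τ P := Finpartition.ext (show permParts (σ * τ) P = (permParts τ P).image _ by
    simp [permParts, image_image, Function.comp_def])

theorem smul_parts (σ : Equiv.Perm (Fin L)) : (σ • P).parts = permParts σ P := rfl

theorem smul_part_eq_iff (σ : Equiv.Perm (Fin L)) (i j : Fin L) :
    (σ • P).part (σ i) = (σ • P).part (σ j) ↔ P.part i = P.part j := by
  have h : ∀ i, (σ • P).part (σ i) = (P.part i).image σ := fun i =>
    Finpartition.part_eq_of_mem _ (mem_image_of_mem _ (P.part_mem.2 (mem_univ i)))
      (mem_image_of_mem _ (P.mem_part (mem_univ i)))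
  rw [h, h, (image_injective σ.injective).eq_iff]

/-- The element `i` is the smallest one of its block. -/
def IsFirst (P : Finpartition (Finset.univ : Finset (Fin L))) (i : Fin L) : Prop :=
  ∀ j < i, P.part j ≠ P.part i

/-- The element `i` is the largest one of its block. -/
def IsLast (P : Finpartition (Finset.univ : Finset (Fin L))) (i : Fin L) : Prop :=
  ∀ j, i < j → P.part j ≠ P.part i

/-- The blocks having an element smaller than `j` and an element that is at least `j`. -/
def openBefore (P : Finpartition (Finset.univ : Finset (Fin L))) (j : ℕ) :
    Finset (Finset (Fin L)) :=
  P.parts.filter fun B => (∃ x ∈ B, (x : ℕ) < j) ∧ ∃ y ∈ B, j ≤ (y : ℕ)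

/-- The blocks having an element that is at most `i` and an element that is at least `i`. -/
def openAt (P : Finpartition (Finset.univ : Finset (Fin L))) (i : Fin L) :
    Finset (Finset (Fin L)) :=
  P.parts.filter fun B => (∃ x ∈ B, x ≤ i) ∧ ∃ y ∈ B, i ≤ y

theorem mem_openBefore {j : ℕ} {B : Finset (Fin L)} : B ∈ openBefore P j ↔
    B ∈ P.parts ∧ (∃ x, P.part x = B ∧ (x : ℕ) < j) ∧ ∃ y, P.part y = B ∧ j ≤ (y : ℕ) := by
  rw [openBefore, mem_filter, and_congr_right]
  intro hB
  simp only [P.part_eq_iff_mem hB]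

theorem mem_openAt {i : Fin L} {B : Finset (Fin L)} : B ∈ openAt P i ↔
    B ∈ P.parts ∧ (∃ x, P.part x = B ∧ x ≤ i) ∧ ∃ y, P.part y = B ∧ i ≤ y := by
  rw [openAt, mem_filter, and_congr_right]
  intro hB
  simp only [P.part_eq_iff_mem hB]

theorem part_mem_openAt (i : Fin L) : P.part i ∈ openAt P i :=
  mem_openAt.2 ⟨P.part_mem.2 (mem_univ i), ⟨i, rfl, le_rfl⟩, ⟨i, rfl, le_rfl⟩⟩

open Classical in
theorem card_openAt_eq_openBefore (i : Fin L) :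
    (openAt P i).card = (openBefore P i).card + (decide (IsFirst P i)).toNat := by
  have hsub : openBefore P i ⊆ openAt P i := fun B hB => by
    rw [mem_openBefore] at hB
    obtain ⟨hB, ⟨x, hx, hxi⟩, y, hy, hyi⟩ := hB
    exact mem_openAt.2 ⟨hB, ⟨x, hx, (Fin.lt_def.2 hxi).le⟩, y, hy, hyi⟩
  have hother : ∀ B ∈ openAt P i, B ≠ P.part i → B ∈ openBefore P i := fun B hB hne => by
    rw [mem_openAt] at hB
    obtain ⟨hB, ⟨x, hx, hxi⟩, y, hy, hyi⟩ := hB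
    refine mem_openBefore.2 ⟨hB, ⟨x, hx, lt_of_le_of_ne hxi ?_⟩, y, hy, hyi⟩
    rintro h
    exact hne (by rw [← hx, Fin.ext h])
  by_cases h : IsFirst P i
  · have hnot : P.part i ∉ openBefore P i := fun hB => by
      obtain ⟨-, ⟨x, hx, hxi⟩, -⟩ := mem_openBefore.1 hB
      exact h x hxi hx
    have : openAt P i = insert (P.part i) (openBefore P i) := by
      ext B
      rw [mem_insert]
      refine ⟨fun hB => or_iff_not_imp_left.2 (hother B hB), ?_⟩
      rintro (rfl | hB)
      exacts [part_mem_openAt i, hsub hB]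
    rw [this, card_insert_of_notMem hnot]
    simp [h]
  · have : openAt P i = openBefore P i := by
      refine Subset.antisymm (fun B hB => ?_) hsub
      by_cases hne : B = P.part i
      · subst hne
        simp only [IsFirst, not_forall, not_not] at h
        obtain ⟨x, hxi, hx⟩ := h
        exact mem_openBefore.2 ⟨P.part_mem.2 (mem_univ i), ⟨x, hx, hxi⟩, i, rfl, le_rfl⟩
      · exact hother B hB hne
    simp [this, h]

open Classical in
theorem card_openAt_eq_openBefore_succ (i : Fin L) :
    (openAt P i).card = (openBefore P (i + 1)).card + (decide (IsLast P i)).toNat := by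
  have hsub : openBefore P (i + 1) ⊆ openAt P i := fun B hB => by
    rw [mem_openBefore] at hB
    obtain ⟨hB, ⟨x, hx, hxi⟩, y, hy, hyi⟩ := hB
    exact mem_openAt.2 ⟨hB, ⟨x, hx, Fin.le_def.2 (by omega)⟩, y, hy, Fin.le_def.2 (by omega)⟩
  have hother : ∀ B ∈ openAt P i, B ≠ P.part i → B ∈ openBefore P (i + 1) := fun B hB hne => by
    rw [mem_openAt] at hB
    obtain ⟨hB, ⟨x, hx, hxi⟩, y, hy, hyi⟩ := hB
    refine mem_openBefore.2 ⟨hB, ⟨x, hx, Nat.lt_succ_of_le hxi⟩, y, hy,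
      Nat.succ_le_of_lt (lt_of_le_of_ne hyi ?_)⟩
    rintro h
    exact hne (by rw [← hy, Fin.ext h])
  by_cases h : IsLast P i
  · have hnot : P.part i ∉ openBefore P (i + 1) := fun hB => by
      obtain ⟨-, -, y, hy, hyi⟩ := mem_openBefore.1 hB
      exact h y hyi hy
    have : openAt P i = insert (P.part i) (openBefore P (i + 1)) := by
      ext B
      rw [mem_insert]
      refine ⟨fun hB => or_iff_not_imp_left.2 (hother B hB), ?_⟩
      rintro (rfl | hB)
      exacts [part_mem_openAt i, hsub hB]
    rw [this, card_insert_of_notMem hnot]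
    simp [h]
  · have : openAt P i = openBefore P (i + 1) := by
      refine Subset.antisymm (fun B hB => ?_) hsub
      by_cases hne : B = P.part i
      · subst hne
        simp only [IsLast, not_forall, not_not] at h
        obtain ⟨y, hyi, hy⟩ := h
        exact mem_openBefore.2 ⟨P.part_mem.2 (mem_univ i), ⟨i, rfl, Nat.lt_succ_self _⟩, y, hy, hyi⟩
      · exact hother B hB hne
    simp [this, h]

theorem isFirst_or_card_openBefore_pos (i : Fin L) :
    IsFirst P i ∨ 0 < (openBefore P i).card := by
  refine or_iff_not_imp_left.2 fun h => ?_
  simp only [IsFirst, not_forall, not_not] at h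
  obtain ⟨x, hxi, hx⟩ := h
  exact card_pos.2 ⟨P.part i,
    mem_openBefore.2 ⟨P.part_mem.2 (mem_univ i), ⟨x, hx, hxi⟩, i, rfl, le_rfl⟩⟩

theorem NonCrossing.openAt_subset (hP : NonCrossing P) {i k j : Fin L} (hij : i ≤ j) (hjk : j ≤ k)
    (h : P.part i = P.part k) : openAt P i ⊆ openAt P j ∧ openAt P k ⊆ openAt P j := by
  rw [nonCrossing_iff_s5] at hP
  constructor
  · intro B hB
    rw [mem_openAt] at hB ⊢
    obtain ⟨hB, ⟨x, rfl, hxi⟩, y, hy, hyi⟩ := hB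
    refine ⟨hB, ⟨x, rfl, hxi.trans hij⟩, ?_⟩
    by_cases hne : P.part x = P.part i
    · exact ⟨k, by rw [hne, h], hjk⟩
    · refine ⟨y, hy, ?_⟩
      by_contra! hlt
      have h1 : x < i := lt_of_le_of_ne hxi (by rintro rfl; exact hne rfl)
      have h2 : i < y := lt_of_le_of_ne hyi (by rintro rfl; exact hne hy.symm)
      exact hne (hP x i y k h1 h2 (hlt.trans_le hjk) hy.symm h)
  · intro B hB
    rw [mem_openAt] at hB ⊢
    obtain ⟨hB, ⟨x, rfl, hxi⟩, y, hy, hyi⟩ := hB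
    refine ⟨hB, ?_, ⟨y, hy, hjk.trans hyi⟩⟩
    by_cases hne : P.part x = P.part i
    · exact ⟨i, hne.symm, hij⟩
    · refine ⟨x, rfl, ?_⟩
      by_contra! hlt
      have h1 : x < k := lt_of_le_of_ne hxi (by rintro rfl; exact hne h.symm)
      have h2 : k < y := lt_of_le_of_ne hyi (by rintro rfl; exact hne (hy.symm.trans h.symm))
      exact hne (hP i x k y (hij.trans_lt hlt) h1 h2 h hy.symm).symm

theorem NonCrossing.part_eq_iff (hP : NonCrossing P) {i k : Fin L} (hik : i < k) :
    P.part i = P.part k ↔ (openAt P i).card = (openAt P k).card ∧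
      ∀ j : ℕ, (i : ℕ) < j → j ≤ k → (openAt P i).card ≤ (openBefore P j).card := by
  constructor
  · intro h
    refine ⟨congrArg card (Subset.antisymm (hP.openAt_subset hik.le le_rfl h).1
      (hP.openAt_subset le_rfl hik.le h).2), fun j hij hjk => card_le_card fun B hB => ?_⟩
    have hB' := (hP.openAt_subset hik.le le_rfl h).1 hB
    rw [mem_openAt] at hB hB'
    obtain ⟨hB, ⟨x, hx, hxi⟩, -⟩ := hB
    obtain ⟨-, -, y, hy, hyk⟩ := hB'
    exact mem_openBefore.2 ⟨hB, ⟨x, hx, lt_of_le_of_lt hxi hij⟩, y, hy, hjk.trans hyk⟩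
  · rintro ⟨hcard, hopen⟩
    have hNC := nonCrossing_iff_s5.1 hP
    obtain ⟨e, he, hke⟩ : ∃ e, P.part e = P.part i ∧ k ≤ e := by
      by_contra! hlt
      obtain ⟨e, he, hmax⟩ := (univ.filter fun e => P.part e = P.part i).exists_maximal
        ⟨i, by simp⟩
      simp only [mem_filter, mem_univ, true_and] at he hmax
      have hmax' : ∀ y, P.part y = P.part i → y ≤ e := fun y hy => by
        by_contra! hey
        exact absurd (hmax hy hey.le) (not_le.2 hey)
      have hie : i ≤ e := hmax' i rfl
      refine absurd (hopen (e + 1) (Nat.lt_succ_of_le hie) (hlt e he)) (not_le.2 ?_)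
      refine card_lt_card ((ssubset_iff_of_subset fun B hB => ?_).2 ⟨P.part i, part_mem_openAt i, ?_⟩)
      · rw [mem_openBefore] at hB
        obtain ⟨hB, ⟨x, hx, hxe⟩, y, hy, hye⟩ := hB
        have hey : e < y := hye
        refine mem_openAt.2 ⟨hB, ⟨x, hx, ?_⟩, y, hy, hie.trans hey.le⟩
        by_contra! hix
        have hne : P.part i ≠ P.part x := fun h =>
          absurd (hmax' y (by rw [hy, ← hx, h])) (not_le.2 hey)
        have hxe' : x < e := lt_of_le_of_ne (Nat.le_of_lt_succ hxe) (by rintro rfl; exact hne he.symm)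
        exact hne (hNC i x e y hix hxe' hey he.symm (hx.trans hy.symm))
      · intro hB
        obtain ⟨-, -, y, hy, hye⟩ := mem_openBefore.1 hB
        exact absurd (hmax' y hy) (not_le.2 hye)
    have hsub : openAt P i ⊆ openAt P k := fun B hB => by
      have hB' := (hP.openAt_subset (hik.le.trans hke) le_rfl he.symm).1 hB
      rw [mem_openAt] at hB hB' ⊢
      exact ⟨hB.1, ⟨hB.2.1.choose, hB.2.1.choose_spec.1, hB.2.1.choose_spec.2.trans hik.le⟩,
        ⟨hB'.2.2.choose, hB'.2.2.choose_spec.1, hke.trans hB'.2.2.choose_spec.2⟩⟩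
    have hk : P.part k ∈ openAt P i := by
      rw [eq_of_subset_of_card_le hsub hcard.ge]
      exact part_mem_openAt k
    obtain ⟨-, ⟨x, hx, hxi⟩, -⟩ := mem_openAt.1 hk
    by_contra hne
    have h1 : x < i := lt_of_le_of_ne hxi (by rintro rfl; exact hne hx)
    have h2 : k < e := lt_of_le_of_ne hke (by rintro rfl; exact hne he.symm)
    exact hne (by rw [← hx]; exact (hNC x i k e h1 hik h2 hx he.symm).symm)

end Blocks

section Words

variable {L : ℕ} {P Q : Finpartition (Finset.univ : Finset (Fin L))}

open Classical in
/-- The word of a partition: the letter at `i` says whether `i` is the smallest and whether it is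
the largest element of its block. -/
noncomputable def blockWord (P : Finpartition (Finset.univ : Finset (Fin L))) (i : ℕ) :
    Bool × Bool :=
  if h : i < L then (decide (IsFirst P ⟨i, h⟩), decide (IsLast P ⟨i, h⟩)) else (false, false)

theorem openCount_congr {u v : ℕ → Bool × Bool} (a : ℕ) {j : ℕ} (h : ∀ i < j, u i = v i) :
    openCount u a j = openCount v a j := by
  induction j with
  | zero => rfl
  | succ j ih => rw [openCount, openCount, ih fun i hi => h i (by omega), h j (by omega)]

theorem openCount_blockWord {j : ℕ} (hj : j ≤ L) :
    openCount (blockWord P) 0 j = (openBefore P j).card := by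
  induction j with
  | zero => simp [openCount, openBefore]
  | succ j ih =>
    have h1 := card_openAt_eq_openBefore (P := P) ⟨j, hj⟩
    have h2 := card_openAt_eq_openBefore_succ (P := P) ⟨j, hj⟩
    have hw : blockWord P j = _ := dif_pos (show j < L from hj)
    rw [openCount, ih (by omega), hw]
    simp only at h1 h2 ⊢
    omega

theorem NonCrossing.eq_of_blockWord_eq (hP : NonCrossing P) (hQ : NonCrossing Q)
    (h : ∀ i < L, blockWord P i = blockWord Q i) : P = Q := by
  have hbefore : ∀ j ≤ L, (openBefore P j).card = (openBefore Q j).card := fun j hj => by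
    rw [← openCount_blockWord hj, ← openCount_blockWord hj,
      openCount_congr 0 fun i hi => h i (by omega)]
  have hat : ∀ i, (openAt P i).card = (openAt Q i).card := fun i => by
    have hi := h i i.2
    rw [blockWord, blockWord, dif_pos i.2, dif_pos i.2] at hi
    rw [card_openAt_eq_openBefore, card_openAt_eq_openBefore, hbefore i i.2.le]
    exact congrArg _ (congrArg (fun x => x.1.toNat) hi)
  have hlt : ∀ i k, i < k → (P.part i = P.part k ↔ Q.part i = Q.part k) := fun i k hik => by
    rw [hP.part_eq_iff hik, hQ.part_eq_iff hik, hat, hat]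
    refine and_congr_right fun _ => forall_congr' fun j => forall_congr' fun _ =>
      forall_congr' fun hj => ?_
    rw [hbefore j (by omega)]
  refine finpartition_ext_part fun i k => ?_
  rcases lt_trichotomy i k with hik | rfl | hik
  · exact hlt i k hik
  · simp
  · rw [eq_comm, hlt k i hik, eq_comm]

/-- The position, in the stack of open blocks, of the block of the element `i`. -/
def depth (u : ℕ → Bool × Bool) (i : ℕ) : ℕ := openCount u 0 i + (u i).1.toNat

/-- Two elements are related when their blocks have the same position in the stack of open blocks
and this block has not been closed between them. -/
def wordSetoid (u : ℕ → Bool × Bool) (L : ℕ) : Setoid (Fin L) where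
  r i k := depth u i = depth u k ∧
    ∀ j : ℕ, min (i : ℕ) k < j → j ≤ max (i : ℕ) k → depth u i ≤ openCount u 0 j
  iseqv :=
    { refl := fun i => ⟨rfl, fun j h1 h2 => by omega⟩
      symm := fun {i k} h => ⟨h.1.symm, fun j h1 h2 => by
        rw [← h.1]; exact h.2 j (by omega) (by omega)⟩
      trans := fun {i k l} h h' => ⟨h.1.trans h'.1, fun j h1 h2 => by
        by_cases hj : min (i : ℕ) k < j ∧ j ≤ max (i : ℕ) k
        · exact h.2 j hj.1 hj.2
        · rw [h.1]
          exact h'.2 j (by omega) (by omega)⟩ }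

open Classical in
/-- The partition with a given word. -/
noncomputable def wordPartition (u : ℕ → Bool × Bool) (L : ℕ) :
    Finpartition (Finset.univ : Finset (Fin L)) :=
  Finpartition.ofSetoid (wordSetoid u L)

theorem wordPartition_part_eq_iff (u : ℕ → Bool × Bool) (i k : Fin L) :
    (wordPartition u L).part i = (wordPartition u L).part k ↔ depth u i = depth u k ∧
      ∀ j : ℕ, min (i : ℕ) k < j → j ≤ max (i : ℕ) k → depth u i ≤ openCount u 0 j := by
  classical
  rw [eq_comm, part_eq_part_iff_mem]
  exact Finpartition.mem_part_ofSetoid_iff_rel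

theorem nonCrossing_wordPartition (u : ℕ → Bool × Bool) : NonCrossing (wordPartition u L) := by
  rw [nonCrossing_iff_s5]
  intro a b c d hab hbc hcd hac hbd
  rw [Fin.lt_def] at hab hbc hcd
  rw [wordPartition_part_eq_iff] at hac hbd ⊢
  obtain ⟨h1, h2⟩ := hac
  obtain ⟨h3, h4⟩ := hbd
  have e1 := h2 b (by omega) (by omega)
  have e2 := h4 c (by omega) (by omega)
  have e3 : openCount u 0 b ≤ depth u b := Nat.le_add_right _ _
  have e4 : openCount u 0 c ≤ depth u c := Nat.le_add_right _ _
  exact ⟨by omega, fun j hj hj' => h2 j (by omega) (by omega)⟩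

theorem isFirst_wordPartition {u : ℕ → Bool × Bool} (hu : u ∈ openWords L 0) (i : Fin L) :
    IsFirst (wordPartition u L) i ↔ (u i).1 = true := by
  constructor
  · intro h
    by_contra hs
    rw [Bool.not_eq_true] at hs
    have hpos : 0 < openCount u 0 i := by simpa [hs] using hu.2 i i.2
    have hdi : depth u i = openCount u 0 i := by simp [depth, hs]
    have hex : ∃ t, t ≤ (i : ℕ) ∧ ∀ j, t < j → j ≤ i → openCount u 0 i ≤ openCount u 0 j :=
      ⟨i, le_rfl, fun j h1 h2 => by omega⟩
    classical
    obtain ⟨ht, hmin⟩ := Nat.find_spec hex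
    set t := Nat.find hex with htdef
    have hlt : openCount u 0 t < openCount u 0 i := by
      by_contra! hge
      rcases Nat.eq_zero_or_pos t with h0 | h0
      · rw [h0] at hge
        exact absurd hge (not_le.2 hpos)
      · refine Nat.find_min hex (m := t - 1) (by omega) ⟨by omega, fun j h1 h2 => ?_⟩
        rcases eq_or_ne j t with rfl | hne
        · exact hge
        · exact hmin j (by omega) h2
    have hti : t < i := lt_of_le_of_ne ht (by rintro e; rw [e] at hlt; omega)
    have hstep := hmin (t + 1) (by omega) hti
    rw [openCount] at hstep
    have hdt : depth u t = openCount u 0 i := by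
      have := Bool.toNat_le (u t).1
      unfold depth
      omega
    refine h ⟨t, hti.trans i.2⟩ hti ((wordPartition_part_eq_iff u _ _).2 ⟨by rw [hdi]; exact hdt,
      fun j h1 h2 => ?_⟩)
    simp only at h1 h2 ⊢
    rw [hdt]
    exact hmin j (by omega) (by omega)
  · intro hs j hji hj
    obtain ⟨h1, h2⟩ := (wordPartition_part_eq_iff u _ _).1 hj
    rw [Fin.lt_def] at hji
    have := h2 i (by omega) (by omega)
    rw [h1, depth, hs, Bool.toNat_true] at this
    omega

theorem isLast_wordPartition {u : ℕ → Bool × Bool} (hu : u ∈ openWords L 0)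
    (hend : openCount u 0 L = 0) (i : Fin L) :
    IsLast (wordPartition u L) i ↔ (u i).2 = true := by
  have hdpos : ∀ k < L, 0 < depth u k := fun k hk => by
    unfold depth
    rcases hu.2 k hk with h | h
    · simp [h]
    · omega
  have hsucc : ∀ k, openCount u 0 (k + 1) = depth u k - (u k).2.toNat := fun k => rfl
  have hi := hdpos i i.2
  have hsi := hsucc i
  constructor
  · intro h
    by_contra hs
    rw [Bool.not_eq_true] at hs
    rw [hs, Bool.toNat_false, Nat.sub_zero] at hsi
    have hex : ∃ t, (i : ℕ) < t ∧ t ≤ L ∧ openCount u 0 t < depth u i :=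
      ⟨L, i.2, le_rfl, by omega⟩
    classical
    obtain ⟨h1, h2, h3⟩ := Nat.find_spec hex
    have hmin : ∀ j : ℕ, i < j → j < Nat.find hex → depth u i ≤ openCount u 0 j :=
      fun j hij hj => by
        by_contra! hlt
        exact Nat.find_min hex hj ⟨hij, by omega, hlt⟩
    obtain ⟨k, hk⟩ : ∃ k, Nat.find hex = k + 1 := ⟨Nat.find hex - 1, by omega⟩
    rw [hk] at h1 h2 h3 hmin
    have hik : (i : ℕ) < k := by
      refine lt_of_le_of_ne (Nat.le_of_lt_succ h1) ?_
      rintro e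
      rw [← e, hsi] at h3
      omega
    have hak := hmin k hik (Nat.lt_succ_self k)
    have hsk := hsucc k
    have hle := Bool.toNat_le (u k).2
    have hdk : openCount u 0 k ≤ depth u k := Nat.le_add_right _ _
    refine h ⟨k, h2⟩ hik ((wordPartition_part_eq_iff u _ _).2 ?_)
    have heq : depth u k = depth u i := by omega
    refine ⟨heq, fun j hj1 hj2 => ?_⟩
    simp only at hj1 hj2 ⊢
    rw [heq]
    exact hmin j (by omega) (by omega)
  · intro hs j hij hj
    obtain ⟨h1, h2⟩ := (wordPartition_part_eq_iff u _ _).1 hj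
    rw [Fin.lt_def] at hij
    have := h2 (i + 1) (by omega) (by omega)
    rw [h1, hsi, hs, Bool.toNat_true] at this
    omega

theorem blockWord_wordPartition {u : ℕ → Bool × Bool} (hu : u ∈ openWords L 0)
    (hend : openCount u 0 L = 0) {i : ℕ} (hi : i < L) :
    blockWord (wordPartition u L) i = u i := by
  classical
  rw [blockWord, dif_pos hi]
  ext
  · exact (Bool.decide_congr (isFirst_wordPartition hu ⟨i, hi⟩)).trans Bool.decide_eq_true
  · exact (Bool.decide_congr (isLast_wordPartition hu hend ⟨i, hi⟩)).trans Bool.decide_eq_true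

/-- The word `v` of length `m` followed by its mirror image. -/
def mirrorWord (m : ℕ) (v : ℕ → Bool × Bool) (i : ℕ) : Bool × Bool :=
  if i < m then v i else if i < 2 * m then (v (2 * m - 1 - i)).swap else (false, false)

theorem openCount_mirrorWord {m : ℕ} {v : ℕ → Bool × Bool} (hv : v ∈ openWords m 0) {k : ℕ}
    (hk : k ≤ m) : openCount (mirrorWord m v) 0 (2 * m - k) = openCount v 0 k := by
  induction hk using Nat.decreasingInduction with
  | self =>
    rw [show 2 * m - m = m by omega]
    exact openCount_congr 0 fun i hi => if_pos hi
  | of_succ k hk ih =>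
    rw [show 2 * m - k = 2 * m - (k + 1) + 1 by omega, openCount, ih, mirrorWord,
      if_neg (by omega), if_pos (by omega), show 2 * m - 1 - (2 * m - (k + 1)) = k by omega,
      openCount, Prod.fst_swap, Prod.snd_swap]
    have := Bool.toNat_le (v k).2
    rcases hv.2 k hk with h | h
    · simp only [h, Bool.toNat_true]
      omega
    · omega

theorem mirrorWord_mem_openWords {m : ℕ} {v : ℕ → Bool × Bool} (hv : v ∈ openWords m 0) :
    mirrorWord m v ∈ openWords (2 * m) 0 := by
  refine ⟨fun i hi => by rw [mirrorWord, if_neg (by omega), if_neg (by omega)], fun i hi => ?_⟩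
  by_cases him : i < m
  · rw [openCount_congr 0 (u := mirrorWord m v) (v := v) fun j hj => if_pos (hj.trans him),
      mirrorWord, if_pos him]
    exact hv.2 i him
  · obtain ⟨k, hk, rfl⟩ : ∃ k < m, i = 2 * m - (k + 1) := ⟨2 * m - 1 - i, by omega, by omega⟩
    rw [openCount_mirrorWord hv hk, mirrorWord,
      if_neg (by omega), if_pos (by omega), show 2 * m - 1 - (2 * m - (k + 1)) = k by omega,
      openCount, Prod.fst_swap]
    rcases hv.2 k hk with h | h <;> rcases he : (v k).2 <;> simp [h]

theorem IsFirst.smul_iff {τ : Equiv.Perm (Fin L)} (hτ : ∀ i j, τ i < τ j ↔ j < i) (i : Fin L) :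
    IsFirst (τ • P) (τ i) ↔ IsLast P i := by
  simp only [IsFirst, IsLast]
  rw [← τ.forall_congr_right]
  simp only [hτ, ne_eq, smul_part_eq_iff]

theorem IsLast.smul_iff {τ : Equiv.Perm (Fin L)} (hτ : ∀ i j, τ i < τ j ↔ j < i) (i : Fin L) :
    IsLast (τ • P) (τ i) ↔ IsFirst P i := by
  simp only [IsFirst, IsLast]
  rw [← τ.forall_congr_right]
  simp only [hτ, ne_eq, smul_part_eq_iff]

theorem NonCrossing.smul_of_reverse {τ : Equiv.Perm (Fin L)} (hτ : ∀ i j, τ i < τ j ↔ j < i)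
    (hP : NonCrossing P) : NonCrossing (τ • P) := by
  rw [nonCrossing_iff_s5] at hP ⊢
  intro a b c d hab hbc hcd hac hbd
  obtain ⟨a, rfl⟩ := τ.surjective a
  obtain ⟨b, rfl⟩ := τ.surjective b
  obtain ⟨c, rfl⟩ := τ.surjective c
  obtain ⟨d, rfl⟩ := τ.surjective d
  rw [hτ] at hab hbc hcd
  rw [smul_part_eq_iff] at hac hbd ⊢
  rw [hac, ← hP d c b a hcd hbc hab hbd.symm hac.symm, hbd]

theorem NonCrossing.smul_of_rotate {ρ : Equiv.Perm (Fin L)}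
    (hρ : ∀ i : Fin L, (ρ i : ℕ) = (i + 1) % L) (hP : NonCrossing P) : NonCrossing (ρ • P) := by
  rw [nonCrossing_iff_s5] at hP ⊢
  intro a b c d hab hbc hcd hac hbd
  obtain ⟨a, rfl⟩ := ρ.surjective a
  obtain ⟨b, rfl⟩ := ρ.surjective b
  obtain ⟨c, rfl⟩ := ρ.surjective c
  obtain ⟨d, rfl⟩ := ρ.surjective d
  have hval : ∀ i : Fin L, (ρ i : ℕ) = i + 1 ∨ ((ρ i : ℕ) = 0 ∧ (i : ℕ) + 1 = L) := fun i => by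
    rcases Nat.lt_or_ge (i + 1) L with h | h
    · exact Or.inl (by rw [hρ, Nat.mod_eq_of_lt h])
    · have : (i : ℕ) + 1 = L := by omega
      exact Or.inr ⟨by rw [hρ, this, Nat.mod_self], this⟩
  rw [Fin.lt_def] at hab hbc hcd
  rw [smul_part_eq_iff] at hac hbd ⊢
  have ha := hval a
  have hb : (ρ b : ℕ) = b + 1 := (hval b).resolve_right (by omega)
  have hc : (ρ c : ℕ) = c + 1 := (hval c).resolve_right (by omega)
  have hd : (ρ d : ℕ) = d + 1 := (hval d).resolve_right (by omega)
  rcases ha with ha | ⟨-, ha⟩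
  · exact hP a b c d (Fin.lt_def.2 (by omega)) (Fin.lt_def.2 (by omega)) (Fin.lt_def.2 (by omega))
      hac hbd
  · have hda : d < a := by
      refine lt_of_le_of_ne (Fin.le_def.2 (by omega)) ?_
      rintro rfl
      omega
    rw [hac, ← hP b c d a (Fin.lt_def.2 (by omega)) (Fin.lt_def.2 (by omega)) hda hbd hac.symm]

theorem blockWord_smul {τ : Equiv.Perm (Fin L)} (hτ : ∀ i, (τ i : ℕ) = L - 1 - i)
    {i : ℕ} (hi : i < L) : blockWord (τ • P) i = (blockWord P (L - 1 - i)).swap := by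
  classical
  have hτ' : ∀ i j, τ i < τ j ↔ j < i := fun i j => by
    rw [Fin.lt_def, Fin.lt_def, hτ, hτ]; omega
  have h : (⟨i, hi⟩ : Fin L) = τ ⟨L - 1 - i, by omega⟩ := Fin.ext (by rw [hτ]; simp only; omega)
  rw [blockWord, blockWord, dif_pos hi, dif_pos (by omega), h]
  simp only [IsFirst.smul_iff hτ', IsLast.smul_iff hτ', Prod.swap_prod_mk]

/-- The non-crossing partitions fixed by the reflection are in bijection with the words of their
first half. -/
theorem ncard_nonCrossing_fixed {m : ℕ} (τ : Equiv.Perm (Fin (2 * m)))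
    (hτ : ∀ i, (τ i : ℕ) = 2 * m - 1 - i) :
    {P : Finpartition (Finset.univ : Finset (Fin (2 * m))) | NonCrossing P ∧ τ • P = P}.ncard =
      (2 * m).choose m := by
  have hτ' : ∀ i j, τ i < τ j ↔ j < i := fun i j => by
    rw [Fin.lt_def, Fin.lt_def, hτ, hτ]; omega
  set f : Finpartition (Finset.univ : Finset (Fin (2 * m))) → ℕ → Bool × Bool :=
    fun P i => if i < m then blockWord P i else (false, false) with hf
  have hfm : ∀ P, ∀ i < m, f P i = blockWord P i := fun P i hi => if_pos hi
  have hbij : Set.BijOn f {P | NonCrossing P ∧ τ • P = P} (openWords m 0) := by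
    refine ⟨fun P _ => ⟨fun i hi => if_neg (by omega), fun i hi => ?_⟩, ?_, fun v hv => ?_⟩
    · classical
      have hi' : i < 2 * m := by omega
      rw [openCount_congr 0 fun j hj => hfm P j (hj.trans hi), openCount_blockWord hi'.le,
        hfm P i hi, blockWord, dif_pos hi']
      simpa using isFirst_or_card_openBefore_pos (P := P) ⟨i, hi'⟩
    · rintro P ⟨hP, hPτ⟩ Q ⟨hQ, hQτ⟩ h
      have hlow : ∀ i < m, blockWord P i = blockWord Q i := fun i hi => by
        rw [← hfm P i hi, h, hfm Q i hi]
      refine hP.eq_of_blockWord_eq hQ fun i hi => ?_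
      by_cases him : i < m
      · exact hlow i him
      · rw [← hPτ, ← hQτ, blockWord_smul hτ hi, blockWord_smul hτ hi, hlow _ (by omega)]
    · have hu := mirrorWord_mem_openWords hv
      have hend : openCount (mirrorWord m v) 0 (2 * m) = 0 :=
        openCount_mirrorWord hv (Nat.zero_le m)
      have hNC := nonCrossing_wordPartition (L := 2 * m) (mirrorWord m v)
      refine ⟨wordPartition (mirrorWord m v) (2 * m), ⟨hNC, ?_⟩, funext fun i => ?_⟩
      · refine (hNC.smul_of_reverse hτ').eq_of_blockWord_eq hNC fun i hi => ?_
        rw [blockWord_smul hτ hi, blockWord_wordPartition hu hend hi,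
          blockWord_wordPartition hu hend (by omega)]
        unfold mirrorWord
        by_cases him : i < m
        · rw [if_neg (by omega), if_pos (by omega), if_pos him, Prod.swap_swap]
          congr 1
          omega
        · rw [if_pos (by omega), if_neg him, if_pos hi]
      · by_cases him : i < m
        · rw [hfm _ i him, blockWord_wordPartition hu hend (by omega), mirrorWord, if_pos him]
        · rw [hf, hv.1 i (by omega)]
          exact if_neg him
  rw [Set.ncard_def, ← hbij.injOn.encard_image, hbij.image_eq, encard_openWords]
  simp

end Words

/-- Lemma 2.2 of the paper: for even `L > 0`, letting `N'_L` be the number of orbits of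
non-crossing partitions of `{1,…,L}` under the cyclic group generated by the rotation
`ρ₂(i) = i+2 (mod L)`, and `N_L` the number of orbits under the group generated by `ρ₂`
and the reflection `τ(i) = L+1−i`, one has `2·N_L − N'_L = binom(L, L/2)`. -/
theorem noncrossing_orbits_reflection_relation (L : ℕ) (hL : 0 < L) (hE : Even L)
    (ρ₂ τ : Equiv.Perm (Fin L))
    (hρ : ∀ i : Fin L, ((ρ₂ i : ℕ)) = ((i : ℕ) + 2) % L)
    (hτ : ∀ i : Fin L, ((τ i : ℕ)) = L - 1 - (i : ℕ)) :
    2 * ((((orbitSet (Subgroup.closure {ρ₂, τ})) '' {P | NonCrossing P}).ncard : ℤ))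
        - (((orbitSet (Subgroup.closure {ρ₂})) '' {P | NonCrossing P}).ncard : ℤ)
      = Nat.choose L (L / 2) := by
  obtain ⟨m, rfl⟩ : ∃ m, L = 2 * m := hE.exists_two_nsmul.imp fun m h => by simpa using h
  have : NeZero (2 * m) := ⟨hL.ne'⟩
  have hval : ∀ i : Fin (2 * m), (finRotate (2 * m) i : ℕ) = (i + 1) % (2 * m) := fun i => by
    rw [finRotate_apply, Fin.val_add, Fin.val_one', Nat.add_mod_mod]
  have hsq : ρ₂ = finRotate (2 * m) * finRotate (2 * m) := by
    ext i
    rw [Equiv.Perm.mul_apply, hval, hval, hρ, Nat.mod_add_mod]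
  have hinv : τ * τ = 1 := by
    ext i
    rw [Equiv.Perm.mul_apply, hτ, hτ, Equiv.Perm.one_apply]
    omega
  have hconj : τ * finRotate (2 * m) * τ = (finRotate (2 * m))⁻¹ := by
    rw [eq_inv_iff_mul_eq_one]
    ext i
    simp only [Equiv.Perm.mul_apply, Equiv.Perm.one_apply, hτ, hval]
    rcases Nat.lt_or_ge (i + 1) (2 * m) with h | h
    · rw [Nat.mod_eq_of_lt h, Nat.mod_eq_of_lt (by omega)]
      omega
    · rw [show (i : ℕ) + 1 = 2 * m by omega, Nat.mod_self, Nat.sub_zero,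
        Nat.sub_add_cancel (by omega), Nat.mod_self]
      omega
  have hparity : ∀ σ ∈ Subgroup.closure {ρ₂}, ∀ i : Fin (2 * m), (σ i : ℕ) % 2 = i % 2 := by
    intro σ hσ
    induction hσ using Subgroup.closure_induction with
    | mem σ h =>
      rintro i
      rw [Set.mem_singleton_iff.1 h, hρ, Nat.mod_mul_right_mod, Nat.add_mod_right]
    | one => exact fun i => rfl
    | mul σ σ' _ _ h h' => exact fun i => by rw [Equiv.Perm.mul_apply, h, h']
    | inv σ _ h =>
      intro i
      rw [← h, ← Equiv.Perm.mul_apply, mul_inv_cancel, Equiv.Perm.one_apply]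
  have hnot : τ ∉ Subgroup.closure {finRotate (2 * m) * finRotate (2 * m)} := fun h => by
    have := hparity τ (hsq ▸ h) ⟨0, hL⟩
    rw [hτ] at this
    simp only at this
    omega
  have hτ' : ∀ i j, τ i < τ j ↔ j < i := fun i j => by
    rw [Fin.lt_def, Fin.lt_def, hτ, hτ]
    omega
  have horbit : ∀ H : Subgroup (Equiv.Perm (Fin (2 * m))),
      orbitSet H = fun P => {Q | ∃ σ ∈ H, Q = σ • P} := fun H => by
    funext P
    ext Q
    simp only [orbitSet, Set.mem_ofPred_eq, Finpartition.ext_iff, smul_parts]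
  rw [horbit, horbit, hsq, two_mul_ncard_orbits_sub {P | NonCrossing P} (finRotate (2 * m)) τ hinv
    hconj hnot (fun P hP => hP.smul_of_rotate hval) (fun P hP => hP.smul_of_reverse hτ'),
    Nat.mul_div_cancel_left m two_pos]
  exact_mod_cast ncard_nonCrossing_fixed τ hτ
end
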